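/- For every even integer q ≥ 2 there exists β* > 0 such that for every real β with |β| ≤ β* and every even n ≥ q: the series defining M₀ and ΔM converge and define analytic functions of z for |z| ≤ 2, and E[Z_{n,q}(β)] = (n!/nⁿ)·Mₙ, where Mₙ denotes the coefficient of zⁿ in the Taylor expansion of M(z) = M₀(z)·ΔM(z) at z = 0. -/

import Mathlib

open MeasureTheory Filter

noncomputable section

namespace SYK

attribute [local instance] Classical.propDecidable

/-- The quadratic form on `ℂ^N` with `Q(x) = ½ Σ x_i²`, so that the Clifford
relation reads `ψ_i ψ_j + ψ_j ψ_i = δ_{ij}`. -/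
def Qf (N : ℕ) : QuadraticForm ℂ (Fin N → ℂ) :=
  QuadraticMap.weightedSumSquares ℂ (fun _ : Fin N => (1 / 2 : ℂ))

/-- The complex Clifford algebra with `N` Majorana generators. -/
abbrev Cliff (N : ℕ) := CliffordAlgebra (Qf N)

/-- The Majorana generator `ψ_i`. -/
def psi {N : ℕ} (i : Fin N) : Cliff N :=
  CliffordAlgebra.ι (Qf N) (Pi.single i 1)

/-- `ψ_I = i^{q/2} ψ_{i₁} ⋯ ψ_{i_q}` for `I = {i₁ < ⋯ < i_q}`. -/
def psiSet {N : ℕ} (q : ℕ) (I : Finset (Fin N)) : Cliff N :=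
  (Complex.I) ^ (q / 2) • ((I.sort (· ≤ ·)).map psi).prod

/-- The sign `B(I₁,…,I_m) ∈ {±1}` determined by
`ψ_{I₁} ⋯ ψ_{I_m} = B(I₁,…,I_m) 2^{-qm/2} 1`. -/
def signB {N : ℕ} (q : ℕ) (l : List (Finset (Fin N))) : ℝ :=
  if (l.map (psiSet q)).prod = (((2 : ℂ) ^ (q * l.length / 2))⁻¹) • (1 : Cliff N) then 1 else -1

/-- `b(H) = Σ_{(I₁,…,I_m) ∈ w(H)} B(I₁,…,I_m)` for a multi-hypergraph with
multiplicity function `r` and total multiplicity `m`, the sum running over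
all ordered sequences in which each hyperedge `e` appears exactly `r e` times. -/
def bMulti {N : ℕ} (q : ℕ) (r : Finset (Fin N) → ℕ) (m : ℕ) : ℝ :=
  ∑ f : Fin m → Finset (Fin N),
    if (∀ e, (Finset.univ.filter (fun i => f i = e)).card = r e)
    then signB q (List.ofFn f) else 0

/-- `r` describes a member of `ℋ_{v,Δ}`: a connected `q`-uniform multi-hypergraph on the
vertex set `{1,…,v}` with even multiplicities and total multiplicity `2(v−1+Δ)/(q−1)`. -/
def IsMultiHG (q v Δ : ℕ) (r : Finset (Fin v) → ℕ) : Prop :=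
  (∀ e, r e ≠ 0 → e.card = q) ∧ (∀ e, Even (r e)) ∧
    (∀ a b : Fin v,
      Relation.ReflTransGen (fun a b => ∃ e, r e ≠ 0 ∧ a ∈ e ∧ b ∈ e) a b) ∧
    (q - 1) * (∑ e, r e) = 2 * (v - 1 + Δ)

/-- `σ = ((q−1)!/n^{q−1})^{1/2}`. -/
def sigma (q n : ℕ) : ℝ := Real.sqrt ((q - 1).factorial / (n : ℝ) ^ (q - 1))

/-- `μ_{v,Δ} = (n^{v−1}/v!) Σ_{H ∈ ℋ_{v,Δ}} (β 2^{-q/2} σ)^{m(H)} b(H)/m(H)!`.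
Multi-hypergraphs are encoded by their multiplicity functions; since the total
multiplicity is at most `2(v−1+Δ)`, multiplicities are encoded in `Fin (2(v−1+Δ)+1)`. -/
def muVD (q n : ℕ) (β : ℝ) (v Δ : ℕ) : ℝ :=
  (n : ℝ) ^ (v - 1) / v.factorial *
    ∑ r : Finset (Fin v) → Fin (2 * (v - 1 + Δ) + 1),
      if IsMultiHG q v Δ (fun e => (r e : ℕ)) then
        (β * ((2 : ℝ) ^ (q / 2))⁻¹ * sigma q n) ^ (∑ e, (r e : ℕ)) *
          bMulti q (fun e => (r e : ℕ)) (∑ e, (r e : ℕ)) / (∑ e, (r e : ℕ)).factorial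
      else 0

/-- `M₀(z) = exp(n Σ_{v ≥ 1} μ_{v,0} z^v)`. -/
def M0 (q n : ℕ) (β : ℝ) (z : ℂ) : ℂ :=
  Complex.exp ((n : ℂ) * ∑' v : ℕ, (muVD q n β (v + 1) 0 : ℂ) * z ^ (v + 1))

/-- `ΔM(z) = exp(n Σ_{1 ≤ v ≤ n} Σ_{Δ ≥ 1} μ_{v,Δ} z^v)`. -/
def DeltaM (q n : ℕ) (β : ℝ) (z : ℂ) : ℂ :=
  Complex.exp ((n : ℂ) *
    ∑ v ∈ Finset.Icc 1 n, ∑' Δ : ℕ, (muVD q n β v (Δ + 1) : ℂ) * z ^ v)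

/-- `M = M₀ · ΔM`. -/
def Mfun (q n : ℕ) (β : ℝ) (z : ℂ) : ℂ := M0 q n β z * DeltaM q n β z

/-- `Mₙ`: the coefficient of `zⁿ` in the Taylor expansion of `M` at `0`. -/
def Mcoef (q n : ℕ) (β : ℝ) : ℂ := iteratedDeriv n (Mfun q n β) 0 / n.factorial

def pX : Matrix (Fin 2) (Fin 2) ℂ := !![0, 1; 1, 0]
def pY : Matrix (Fin 2) (Fin 2) ℂ := !![0, -Complex.I; Complex.I, 0]
def pZ : Matrix (Fin 2) (Fin 2) ℂ := !![1, 0; 0, -1]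

/-- The Majorana matrices `ψ_1, …, ψ_{2m}` (zero-based index `i : Fin (2m)`, so that
`ψ_{2j+1}` of the paper is `psiM m ⟨2j⟩` and `ψ_{2j+2}` is `psiM m ⟨2j+1⟩`), realized as
the iterated Kronecker products `2^{-1/2} Z^{⊗j} ⊗ X ⊗ I₂^{⊗(m−j−1)}` resp.
`2^{-1/2} Z^{⊗j} ⊗ Y ⊗ I₂^{⊗(m−j−1)}`, written entrywise with rows and columns
indexed by `Fin m → Fin 2 ≃ Fin 2^m`. -/
def psiM (m : ℕ) (i : Fin (2 * m)) : Matrix (Fin m → Fin 2) (Fin m → Fin 2) ℂ :=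
  fun a b => ((Real.sqrt 2 : ℝ) : ℂ)⁻¹ * ∏ k : Fin m,
    if (k : ℕ) < (i : ℕ) / 2 then pZ (a k) (b k)
    else if (k : ℕ) = (i : ℕ) / 2 then
      (if (i : ℕ) % 2 = 0 then pX (a k) (b k) else pY (a k) (b k))
    else (if a k = b k then 1 else 0)

/-- `ψ_I = i^{q/2} ψ_{i₁} ⋯ ψ_{i_q}` for `I = {i₁ < ⋯ < i_q}` (matrix version). -/
def psiMSet (m q : ℕ) (I : Finset (Fin (2 * m))) :
    Matrix (Fin m → Fin 2) (Fin m → Fin 2) ℂ :=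
  (Complex.I) ^ (q / 2) • ((I.sort (· ≤ ·)).map (psiM m)).prod

/-- The SYK Hamiltonian with Rademacher couplings given by the signs `s`. -/
def Hsyk (m q : ℕ) (s : {I : Finset (Fin (2 * m)) // I.card = q} → Bool) :
    Matrix (Fin m → Fin 2) (Fin m → Fin 2) ℂ :=
  ∑ I : {I : Finset (Fin (2 * m)) // I.card = q},
    (((if s I then 1 else -1) * sigma q (2 * m) : ℝ) : ℂ) • psiMSet m q I.val

/-- Matrix exponential `e^A = Σ_k A^k/k!`. -/
def expM {m : ℕ} (A : Matrix (Fin m → Fin 2) (Fin m → Fin 2) ℂ) :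
    Matrix (Fin m → Fin 2) (Fin m → Fin 2) ℂ :=
  ∑' k : ℕ, ((k.factorial : ℂ))⁻¹ • A ^ k

/-- `E[Z_{n,q}(β)]` for `n = 2m`: the uniform average over all sign choices of
`2^{-n/2} Tr(exp(β H_SYK))`. -/
def EZ (m q : ℕ) (β : ℝ) : ℂ :=
  (∑ s : ({I : Finset (Fin (2 * m)) // I.card = q} → Bool),
      ((2 : ℂ) ^ m)⁻¹ * Matrix.trace (expM ((β : ℂ) • Hsyk m q s))) /
    (2 : ℂ) ^ (Fintype.card {I : Finset (Fin (2 * m)) // I.card = q})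

/-- `f_{n,q}(β) = β⁻¹ log E[Z_{n,q}(β)]` for `n = 2m`. -/
def fEnergy (m q : ℕ) (β : ℝ) : ℝ := β⁻¹ * Real.log (EZ m q β).re

section SeqSum

variable {ι ι' A B : Type*}

/-- Lower the multiplicity of `e` by one. -/
def decr (r : ι → ℕ) (e : ι) : ι → ℕ := fun a => if a = e then r a - 1 else r a

lemma decr_self (r : ι → ℕ) (e : ι) : decr r e e = r e - 1 := by simp [decr]

lemma decr_of_ne (r : ι → ℕ) {e a : ι} (h : a ≠ e) : decr r e a = r a := by simp [decr, h]

lemma card_filter_cons {m : ℕ} (a : ι) (f : Fin m → ι) (e : ι) :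
    (Finset.univ.filter (fun i => (Fin.cons a f : Fin (m + 1) → ι) i = e)).card
      = (if a = e then 1 else 0) + (Finset.univ.filter (fun i => f i = e)).card := by
  rw [Fin.card_filter_univ_succ]
  simp only [Fin.cons_zero, Fin.cons_succ]
  split_ifs <;> omega

lemma count_cons_iff {m : ℕ} (a : ι) (f : Fin m → ι) (r : ι → ℕ) :
    (∀ e, (Finset.univ.filter (fun i => (Fin.cons a f : Fin (m + 1) → ι) i = e)).card = r e) ↔
      r a ≠ 0 ∧ ∀ e, (Finset.univ.filter (fun i => f i = e)).card = (decr r a) e := by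
  simp only [card_filter_cons]
  constructor
  · intro h
    refine ⟨?_, fun e => ?_⟩
    · have := h a
      simp at this
      omega
    · have := h e
      by_cases hae : a = e
      · subst hae; simp [decr_self] at this ⊢; omega
      · simp [hae, decr_of_ne _ (Ne.symm hae)] at this ⊢; omega
  · rintro ⟨h0, h⟩ e
    have := h e
    by_cases hae : a = e
    · subst hae; simp [decr_self] at this ⊢; omega
    · simp [hae, decr_of_ne _ (Ne.symm hae)] at this ⊢; omega

lemma decr_add {r : ι → ℕ} {e : ι} (h : r e ≠ 0) (s : ι → ℕ) :
    decr (r + s) e = (decr r e) + s := by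
  funext a
  by_cases ha : a = e
  · subst ha; simp [decr_self]; omega
  · simp [decr_of_ne _ ha]

lemma ne_zero_of_decr_ne_zero {r : ι → ℕ} {e a : ι} (h : (decr r e) a ≠ 0) : r a ≠ 0 := by
  intro h0
  apply h
  simp [decr, h0]

variable [Fintype ι] [Fintype ι']

/-- The sum of the ordered products `g (f 0) ⋯ g (f (m-1))` over all sequences `f` in which each
index `e` occurs exactly `r e` times. -/
def seqSum [Semiring A] (g : ι → A) (r : ι → ℕ) (m : ℕ) : A :=
  ∑ f : Fin m → ι, if (∀ e, (Finset.univ.filter (fun i => f i = e)).card = r e)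
    then (List.ofFn fun i => g (f i)).prod else 0

lemma sum_fin_succ_fun [AddCommMonoid A] (m : ℕ) (G : (Fin (m + 1) → ι) → A) :
    ∑ f, G f = ∑ e, ∑ f : Fin m → ι, G (Fin.cons e f) := by
  rw [← Fintype.sum_prod_type']
  exact (Fintype.sum_equiv (Fin.consEquiv (fun _ : Fin (m + 1) => ι)) _ _ (fun _ => rfl)).symm

lemma seqSum_zero_right [Semiring A] (g : ι → A) (r : ι → ℕ) :
    seqSum g r 0 = if r = 0 then 1 else 0 := by
  simp only [seqSum, Finset.univ_unique, Finset.sum_singleton]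
  congr 1
  simp [funext_iff, eq_comm]

lemma seqSum_succ [Semiring A] (g : ι → A) (r : ι → ℕ) (m : ℕ) :
    seqSum g r (m + 1) =
      ∑ e, if r e ≠ 0 then g e * seqSum g (decr r e) m else 0 := by
  rw [seqSum, sum_fin_succ_fun]
  refine Finset.sum_congr rfl fun e _ => ?_
  simp only [count_cons_iff]
  by_cases h : r e = 0
  · simp [h]
  · simp only [h, ne_eq, not_false_eq_true, true_and, if_true, seqSum, Finset.mul_sum]
    refine Finset.sum_congr rfl fun f _ => ?_
    split_ifs <;> simp [List.ofFn_succ]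

lemma map_seqSum [Semiring A] [Semiring B] (φ : A →+* B) (g : ι → A) (r : ι → ℕ) (m : ℕ) :
    φ (seqSum g r m) = seqSum (fun e => φ (g e)) r m := by
  simp only [seqSum, map_sum]
  refine Finset.sum_congr rfl fun f _ => ?_
  split_ifs
  · simp [map_list_prod, List.map_ofFn, Function.comp_def]
  · exact map_zero φ

lemma sum_decr {r : ι → ℕ} {e : ι} (h : r e ≠ 0) {m : ℕ} (hm : ∑ a, r a = m + 1) :
    ∑ a, (decr r e) a = m := by
  have h1 : ∀ a, r a = decr r e a + if a = e then 1 else 0 := by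
    intro a
    by_cases ha : a = e
    · subst ha; simp [decr_self]; omega
    · simp [decr_of_ne _ ha, ha]
  rw [Finset.sum_congr rfl fun a _ => h1 a, Finset.sum_add_distrib] at hm
  simpa using hm

lemma commute_seqSum [Semiring A] (g : ι → A) (y : A) (m : ℕ) :
    ∀ r : ι → ℕ, (∀ e, r e ≠ 0 → Commute y (g e)) → Commute y (seqSum g r m) := by
  induction m with
  | zero =>
    intro r _
    rw [seqSum_zero_right]
    split_ifs
    · exact Commute.one_right _
    · exact Commute.zero_right _
  | succ m ih =>
    intro r h
    rw [seqSum_succ]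
    refine Commute.sum_right _ _ _ fun e _ => ?_
    split_ifs with he
    · exact (h e he).mul_right (ih _ fun a ha => h a (ne_zero_of_decr_ne_zero ha))
    · exact Commute.zero_right _

/-- Symmetrized products over mutually commuting, disjointly supported families multiply, up to
the number of shuffles. -/
lemma seqSum_add [Semiring A] (g : ι → A) (m₁ m₂ : ℕ) :
    ∀ r₁ r₂ : ι → ℕ, ∑ e, r₁ e = m₁ → ∑ e, r₂ e = m₂ → (∀ e, r₁ e = 0 ∨ r₂ e = 0) →
      (∀ e e', r₁ e ≠ 0 → r₂ e' ≠ 0 → Commute (g e) (g e')) →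
      seqSum g (r₁ + r₂) (m₁ + m₂)
        = ((m₁ + m₂).choose m₁ : A) * (seqSum g r₁ m₁ * seqSum g r₂ m₂) := by
  induction m₁ generalizing m₂ with
  | zero =>
    intro r₁ r₂ h₁ h₂ _ _
    have : r₁ = 0 := by
      funext e; exact (Finset.sum_eq_zero_iff.mp h₁) e (Finset.mem_univ e)
    subst this
    simp [seqSum_zero_right]
  | succ m₁ ih₁ =>
    induction m₂ with
    | zero =>
      intro r₁ r₂ h₁ h₂ _ _
      have : r₂ = 0 := by
        funext e; exact (Finset.sum_eq_zero_iff.mp h₂) e (Finset.mem_univ e)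
      subst this
      simp [seqSum_zero_right]
    | succ m₂ ih₂ =>
      intro r₁ r₂ h₁ h₂ hd hc
      have key : seqSum g (r₁ + r₂) (m₁ + 1 + (m₂ + 1)) =
          ∑ e, ((if r₁ e ≠ 0 then
              g e * seqSum g ((decr r₁ e) + r₂) (m₁ + (m₂ + 1)) else 0)
            + (if r₂ e ≠ 0 then
              g e * seqSum g (r₁ + (decr r₂ e)) (m₁ + 1 + m₂) else 0)) := by
        rw [show m₁ + 1 + (m₂ + 1) = (m₁ + 1 + m₂) + 1 by ring, seqSum_succ]
        refine Finset.sum_congr rfl fun e _ => ?_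
        have e1 : m₁ + (m₂ + 1) = m₁ + 1 + m₂ := by ring
        rw [e1]
        rcases hd e with h | h
        · by_cases h' : r₂ e = 0
          · simp [h, h']
          · have := decr_add h' r₁
            rw [add_comm r₂ r₁] at this
            simp [h, h', this, add_comm (decr r₂ e)]
        · by_cases h' : r₁ e = 0
          · simp [h, h']
          · simp [h, h', decr_add h']
      rw [key, Finset.sum_add_distrib]
      have s1 : ∑ e, (if r₁ e ≠ 0 then
              g e * seqSum g ((decr r₁ e) + r₂) (m₁ + (m₂ + 1)) else 0)
          = ((m₁ + (m₂ + 1)).choose m₁ : A) *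
            (seqSum g r₁ (m₁ + 1) * seqSum g r₂ (m₂ + 1)) := by
        rw [seqSum_succ g r₁, Finset.sum_mul, Finset.mul_sum]
        refine Finset.sum_congr rfl fun e _ => ?_
        split_ifs with he
        · rw [ih₁ (m₂ + 1) _ _ (sum_decr he h₁) h₂
            (fun a => (hd a).imp (fun h => by simp [decr, h]) id)
            (fun a b ha hb => hc a b (ne_zero_of_decr_ne_zero ha) hb), ← mul_assoc, ← mul_assoc,
            ← (Nat.cast_commute _ _).eq, mul_assoc, mul_assoc, mul_assoc]
        · simp
      have s2 : ∑ e, (if r₂ e ≠ 0 then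
              g e * seqSum g (r₁ + (decr r₂ e)) (m₁ + 1 + m₂) else 0)
          = ((m₁ + 1 + m₂).choose (m₁ + 1) : A) *
            (seqSum g r₁ (m₁ + 1) * seqSum g r₂ (m₂ + 1)) := by
        rw [seqSum_succ g r₂, Finset.mul_sum, Finset.mul_sum]
        refine Finset.sum_congr rfl fun e _ => ?_
        split_ifs with he
        · rw [ih₂ _ _ h₁ (sum_decr he h₂)
            (fun a => (hd a).imp id (fun h => by simp [decr, h]))
            (fun a b ha hb => hc a b ha (ne_zero_of_decr_ne_zero hb)), ← mul_assoc,
            ← (Nat.cast_commute _ _).eq, mul_assoc, ← mul_assoc (g e),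
            (commute_seqSum g (g e) (m₁ + 1) r₁ (fun a ha => (hc a e ha he).symm)).eq, mul_assoc]
        · simp
      rw [s1, s2, ← add_mul, ← Nat.cast_add]
      congr 2
      rw [show m₁ + 1 + (m₂ + 1) = (m₁ + 1 + m₂) + 1 by ring, Nat.choose_succ_succ]
      congr 2
      ring

lemma seqSum_extend [Semiring A] {j : ι → ι'} (hj : Function.Injective j) (g : ι' → A) (m : ℕ) :
    ∀ r : ι → ℕ, seqSum g (Function.extend j r 0) m = seqSum (fun e => g (j e)) r m := by
  induction m with
  | zero =>
    intro r
    rw [seqSum_zero_right, seqSum_zero_right]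
    congr 1
    refine propext ⟨fun h => ?_, fun h => ?_⟩
    · funext e
      rw [← hj.extend_apply r 0 e, h]; rfl
    · subst h
      funext e
      by_cases he : ∃ a, j a = e
      · obtain ⟨a, rfl⟩ := he
        rw [hj.extend_apply]; rfl
      · rw [Function.extend_apply' _ _ _ he]
  | succ m ih =>
    intro r
    rw [seqSum_succ, seqSum_succ]
    symm
    refine Finset.sum_of_injOn j hj.injOn (by simp) ?_ ?_
    · intro e _ he
      have : ¬ ∃ a, j a = e := by simpa using he
      simp [Function.extend_apply' _ _ _ this]
    · intro e _
      rw [hj.extend_apply, ← ih]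
      congr 3
      funext a
      by_cases ha : ∃ b, j b = a
      · obtain ⟨b, rfl⟩ := ha
        simp only [decr, hj.extend_apply, hj.eq_iff]
      · simp [decr, Function.extend_apply' _ _ _ ha]

/-- The multinomial formula for `seqSum` in a commutative ring. -/
lemma prod_factorial_mul_seqSum [CommSemiring A] (g : ι → A) (m : ℕ) :
    ∀ r : ι → ℕ, ∑ e, r e = m →
      ((∏ e, (r e).factorial : ℕ) : A) * seqSum g r m = (m.factorial : A) * ∏ e, g e ^ r e := by
  induction m with
  | zero =>
    intro r hr
    have : r = 0 := by
      funext e; exact (Finset.sum_eq_zero_iff.mp hr) e (Finset.mem_univ e)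
    subst this
    simp [seqSum_zero_right]
  | succ m ih =>
    intro r hr
    have hstep : ∀ e, ((∏ e, (r e).factorial : ℕ) : A) *
        (if r e ≠ 0 then g e * seqSum g (decr r e) m else 0)
          = (r e : A) * ((m.factorial : A) * ∏ e, g e ^ r e) := by
      intro e
      by_cases he : r e = 0
      · simp [he]
      · have h1 : (∏ a, (r a).factorial)
            = r e * ∏ a, ((decr r e) a).factorial := by
          rw [← Finset.mul_prod_erase _ _ (Finset.mem_univ e),
            ← Finset.mul_prod_erase _ (fun a => ((decr r e) a).factorial)
              (Finset.mem_univ e), ← mul_assoc]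
          congr 1
          · simp [decr_self, Nat.mul_factorial_pred he]
          · refine Finset.prod_congr rfl fun a ha => ?_
            simp [decr_of_ne _ (Finset.ne_of_mem_erase ha)]
        have h2 : (∏ a, g a ^ r a) = g e * ∏ a, g a ^ (decr r e) a := by
          rw [← Finset.mul_prod_erase _ _ (Finset.mem_univ e),
            ← Finset.mul_prod_erase _ (fun a => g a ^ (decr r e) a)
              (Finset.mem_univ e), ← mul_assoc]
          congr 1
          · simp [decr_self, mul_pow_sub_one he]
          · refine Finset.prod_congr rfl fun a ha => ?_
            simp [decr_of_ne _ (Finset.ne_of_mem_erase ha)]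
        have h3 := ih _ (sum_decr he hr)
        rw [if_pos he, h1, h2, Nat.cast_mul]
        calc _ = (r e : A) * g e * (((∏ a, ((decr r e) a).factorial : ℕ) : A) *
                  seqSum g (decr r e) m) := by ring
          _ = _ := by rw [h3]; ring
    rw [seqSum_succ, Finset.mul_sum, Finset.sum_congr rfl fun e _ => hstep e, ← Finset.sum_mul,
      ← Nat.cast_sum, hr, ← mul_assoc, ← Nat.cast_mul, Nat.factorial_succ]

lemma sum_pow_eq_sum_ofFn [Semiring A] (g : ι → A) (k : ℕ) :
    (∑ e, g e) ^ k = ∑ f : Fin k → ι, (List.ofFn fun i => g (f i)).prod := by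
  induction k with
  | zero => simp
  | succ k ih =>
    rw [sum_fin_succ_fun, pow_succ', ih, Finset.sum_mul]
    refine Finset.sum_congr rfl fun e _ => ?_
    rw [Finset.mul_sum]
    exact Finset.sum_congr rfl fun f _ => by simp [List.ofFn_succ]

/-- Grouping all sequences by their multiplicity function. -/
lemma sum_seqSum_le (g : ι → ℝ) (hg : ∀ e, 0 ≤ g e) (F : Finset (ι → ℕ)) (m : ℕ) :
    ∑ r ∈ F, seqSum g r m ≤ (∑ e, g e) ^ m := by
  rw [sum_pow_eq_sum_ofFn]
  simp only [seqSum]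
  rw [Finset.sum_comm]
  refine Finset.sum_le_sum fun f _ => ?_
  have h0 : 0 ≤ (List.ofFn fun i => g (f i)).prod := by
    rw [List.prod_ofFn]
    exact Finset.prod_nonneg fun i _ => hg _
  have : ∀ r : ι → ℕ, (∀ e, (Finset.univ.filter (fun i => f i = e)).card = r e) ↔
      (fun e => (Finset.univ.filter (fun i => f i = e)).card) = r := fun r => by
    rw [funext_iff]
  simp only [this, Finset.sum_ite_eq]
  split_ifs
  · exact le_rfl
  · exact h0

end SeqSum

section Clifford

variable {N : ℕ}

lemma psi_mul_psi_add_swap (i j : Fin N) :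
    psi i * psi j + psi j * psi i = if i = j then (1 : Cliff N) else 0 := by
  rw [psi, psi, CliffordAlgebra.ι_mul_ι_add_swap]
  have : QuadraticMap.polar (Qf N) (Pi.single i 1) (Pi.single j 1)
      = if i = j then (1 : ℂ) else 0 := by
    simp only [QuadraticMap.polar, Qf, QuadraticMap.weightedSumSquares_apply, Pi.add_apply,
      smul_eq_mul, ← Finset.sum_sub_distrib]
    rw [Finset.sum_eq_single j]
    · by_cases h : i = j
      · subst h; simp; norm_num
      · simp [h]
    · intro k _ hk
      simp [Pi.single_eq_of_ne hk]
    · simp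
  rw [this]
  split_ifs <;> simp

lemma psi_mul_self (i : Fin N) : psi i * psi i = (1 / 2 : ℂ) • (1 : Cliff N) := by
  have h := psi_mul_psi_add_swap i i
  rw [if_pos rfl, ← two_smul ℂ] at h
  rw [← h, smul_smul]
  norm_num

lemma psi_anticomm {i j : Fin N} (h : i ≠ j) : psi i * psi j = -(psi j * psi i : Cliff N) := by
  have h := (psi_mul_psi_add_swap i j).trans (if_neg h)
  exact eq_neg_of_add_eq_zero_left h

/-- A family satisfying the Majorana relations induces a homomorphism out of the Clifford
algebra. -/
lemma exists_algHom_of_majorana {A : Type*} [Ring A] [Algebra ℂ A] (g : Fin N → A)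
    (hg : ∀ i j, g i * g j + g j * g i = if i = j then 1 else 0) :
    ∃ Φ : Cliff N →ₐ[ℂ] A, ∀ i, Φ (psi i) = g i := by
  have hsq : ∀ v : Fin N → ℂ, (Fintype.linearCombination ℂ g) v *
      (Fintype.linearCombination ℂ g) v = algebraMap ℂ A (Qf N v) := by
    intro v
    have h2 : (2 : ℂ) • ((Fintype.linearCombination ℂ g) v *
        (Fintype.linearCombination ℂ g) v) = (2 : ℂ) • algebraMap ℂ A (Qf N v) := by
      have e1 : (Fintype.linearCombination ℂ g) v * (Fintype.linearCombination ℂ g) v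
          = ∑ i, ∑ j, (v i * v j) • (g i * g j) := by
        simp only [Fintype.linearCombination_apply, Finset.sum_mul_sum, smul_mul_smul_comm]
      have e2 : (Fintype.linearCombination ℂ g) v * (Fintype.linearCombination ℂ g) v
          = ∑ i, ∑ j, (v i * v j) • (g j * g i) := by
        rw [e1, Finset.sum_comm]
        exact Finset.sum_congr rfl fun i _ => Finset.sum_congr rfl fun j _ => by
          rw [mul_comm (v j)]
      rw [two_smul]
      nth_rewrite 1 [e1]
      rw [e2, ← Finset.sum_add_distrib]
      simp only [← Finset.sum_add_distrib, ← smul_add, hg]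
      simp only [smul_ite, smul_zero, Finset.sum_ite_eq, Finset.mem_univ, if_true]
      simp only [Qf, QuadraticMap.weightedSumSquares_apply, Algebra.algebraMap_eq_smul_one,
        Finset.sum_smul]
      rw [Finset.smul_sum]
      refine Finset.sum_congr rfl fun i _ => ?_
      rw [smul_smul]
      congr 1
      simp only [smul_eq_mul]
      ring
    have := congrArg (fun x => (2 : ℂ)⁻¹ • x) h2
    simpa [smul_smul] using this
  refine ⟨CliffordAlgebra.lift (Qf N) ⟨Fintype.linearCombination ℂ g, hsq⟩, fun i => ?_⟩
  rw [psi, CliffordAlgebra.lift_ι_apply]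
  simp [Fintype.linearCombination_apply_single]

lemma algebraMap_cliff_injective : Function.Injective (algebraMap ℂ (Cliff N)) := by
  have : Invertible (2 : ℂ) := invertibleOfNonzero two_ne_zero
  exact (algebraMap ℂ (Cliff N)).injective

/-- Two elements commute up to sign. -/
def SgnComm {A : Type*} [Ring A] (a b : A) : Prop := a * b = b * a ∨ a * b = -(b * a)

lemma SgnComm.symm {A : Type*} [Ring A] {a b : A} (h : SgnComm a b) : SgnComm b a := by
  rcases h with h | h
  · exact Or.inl h.symm
  · exact Or.inr (by rw [h, neg_neg])

lemma SgnComm.mul_right {A : Type*} [Ring A] {a b c : A} (h : SgnComm a b) (h' : SgnComm a c) :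
    SgnComm a (b * c) := by
  unfold SgnComm
  rw [← mul_assoc, mul_assoc b c a]
  rcases h with h | h <;> rcases h' with h' | h' <;> simp [h, mul_assoc, h']

lemma SgnComm.list_prod_right {A : Type*} [Ring A] {a : A} {l : List A}
    (h : ∀ b ∈ l, SgnComm a b) : SgnComm a l.prod := by
  induction l with
  | nil => exact Or.inl (by simp)
  | cons b l ih =>
    rw [List.prod_cons]
    exact (h b (by simp)).mul_right (ih fun c hc => h c (by simp [hc]))

lemma SgnComm.smul_right {A : Type*} [Ring A] [Algebra ℂ A] {a b : A} (h : SgnComm a b) (c : ℂ) :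
    SgnComm a (c • b) := by
  rcases h with h | h
  · exact Or.inl (by simp [h])
  · exact Or.inr (by simp [h])

lemma sgnComm_psi (i j : Fin N) : SgnComm (psi i : Cliff N) (psi j) := by
  by_cases h : i = j
  · subst h; exact Or.inl rfl
  · exact Or.inr (psi_anticomm h)

lemma sgnComm_monomials (l l' : List (Fin N)) :
    SgnComm ((l.map psi).prod : Cliff N) (l'.map psi).prod := by
  refine SgnComm.list_prod_right fun b hb => SgnComm.symm (SgnComm.list_prod_right fun c hc => ?_)
  obtain ⟨i, _, rfl⟩ := List.mem_map.mp hb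
  obtain ⟨j, _, rfl⟩ := List.mem_map.mp hc
  exact sgnComm_psi i j

lemma sgnComm_psiSet (q : ℕ) (I J : Finset (Fin N)) :
    SgnComm (psiSet q I : Cliff N) (psiSet q J) :=
  (((sgnComm_monomials _ _).smul_right _).symm.smul_right _).symm

lemma psi_mul_monomial {i : Fin N} {l : List (Fin N)} (h : i ∉ l) :
    psi i * ((l.map psi).prod : Cliff N) = (-1 : ℂ) ^ l.length • ((l.map psi).prod * psi i) := by
  induction l with
  | nil => simp
  | cons j l ih =>
    simp only [List.mem_cons, not_or] at h
    rw [List.map_cons, List.prod_cons, ← mul_assoc, psi_anticomm h.1, List.length_cons, pow_succ,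
      neg_mul, mul_assoc, ih h.2, mul_smul_comm, mul_assoc]
    simp

lemma commute_monomials {l l' : List (Fin N)} (h : List.Disjoint l l') (hl : Even l'.length) :
    Commute ((l.map psi).prod : Cliff N) (l'.map psi).prod := by
  refine Commute.list_prod_left _ _ fun b hb => ?_
  obtain ⟨i, hi, rfl⟩ := List.mem_map.mp hb
  have := psi_mul_monomial (fun h' => h hi h')
  rwa [hl.neg_one_pow, one_smul] at this

lemma commute_psiSet {q : ℕ} (hq : Even q) {I J : Finset (Fin N)} (hJ : J.card = q)
    (h : Disjoint I J) : Commute (psiSet q I : Cliff N) (psiSet q J) := by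
  refine (Commute.smul_right (Commute.smul_left (commute_monomials ?_ ?_) _) _)
  · intro a ha hb
    rw [Finset.mem_sort] at ha hb
    exact Finset.disjoint_left.mp h ha hb
  · rwa [Finset.length_sort, hJ]

/-- Two elements agree up to sign. -/
def SgnEq {A : Type*} [Ring A] (a b : A) : Prop := a = b ∨ a = -b

lemma SgnEq.trans {A : Type*} [Ring A] {a b c : A} (h : SgnEq a b) (h' : SgnEq b c) :
    SgnEq a c := by
  rcases h with rfl | rfl <;> rcases h' with rfl | rfl <;> simp [SgnEq]

lemma SgnEq.mul {A : Type*} [Ring A] {a b c d : A} (h : SgnEq a b) (h' : SgnEq c d) :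
    SgnEq (a * c) (b * d) := by
  rcases h with rfl | rfl <;> rcases h' with rfl | rfl <;> simp [SgnEq]

lemma SgnComm.mul_mul_mul {A : Type*} [Ring A] {a b : A} (h : SgnComm a b) (c : A) :
    SgnEq (a * (b * (a * c))) (a * a * (b * c)) := by
  rcases h.symm with h | h
  · left
    rw [← mul_assoc b, h, mul_assoc, mul_assoc]
  · right
    rw [← mul_assoc b, h, neg_mul, mul_neg, mul_assoc, mul_assoc]

lemma SgnEq.refl {A : Type*} [Ring A] (a : A) : SgnEq a a := Or.inl rfl

lemma monomial_mul_self (l : List (Fin N)) :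
    SgnEq ((l.map psi).prod * (l.map psi).prod : Cliff N)
      (((2 : ℂ) ^ l.length)⁻¹ • (1 : Cliff N)) := by
  induction l with
  | nil => simp [SgnEq]
  | cons i l ih =>
    rw [List.map_cons, List.prod_cons, mul_assoc]
    have h : SgnComm (psi i : Cliff N) (l.map psi).prod := by
      simpa using sgnComm_monomials [i] l
    refine (h.mul_mul_mul _).trans ?_
    rw [psi_mul_self]
    refine ((SgnEq.refl _).mul ih).trans (Or.inl ?_)
    rw [smul_mul_smul_comm, one_mul, List.length_cons, pow_succ, mul_inv]
    congr 1
    ring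

lemma psiSet_mul_self {q : ℕ} {I : Finset (Fin N)} (hI : I.card = q) :
    SgnEq (psiSet q I * psiSet q I : Cliff N) (((2 : ℂ) ^ q)⁻¹ • (1 : Cliff N)) := by
  have h := monomial_mul_self (I.sort (· ≤ ·))
  rw [Finset.length_sort, hI] at h
  rw [psiSet, smul_mul_smul_comm, ← mul_pow, Complex.I_mul_I]
  rcases neg_one_pow_eq_or ℂ (q / 2) with h' | h'
  · rwa [h', one_smul]
  · rw [h']
    refine SgnEq.trans (Or.inr ?_) h
    simp

/-- A product of `ψ_I` in which every factor occurs an even number of times is a signed power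
of `2`. -/
lemma prod_psiSet_of_even (q : ℕ) (k : ℕ) :
    ∀ l : List (Finset (Fin N)), l.length ≤ k → (∀ e ∈ l, e.card = q) →
      (∀ e, Even (l.count e)) → Even l.length ∧
      SgnEq ((l.map (psiSet q)).prod : Cliff N)
        (((2 : ℂ) ^ (q * l.length / 2))⁻¹ • (1 : Cliff N)) := by
  induction k with
  | zero =>
    intro l hl _ _
    have : l = [] := List.length_eq_zero_iff.mp (by omega)
    subst this
    simp [SgnEq]
  | succ k ih =>
    intro l hl hc he
    cases l with
    | nil => simp [SgnEq]
    | cons e l =>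
      have hmem : e ∈ l := by
        have := he e
        rw [List.count_cons_self] at this
        by_contra h
        rw [List.count_eq_zero_of_not_mem h] at this
        exact absurd this (by decide)
      obtain ⟨s, t, rfl⟩ := List.append_of_mem hmem
      have h1 := ih (s ++ t) (by simp at hl ⊢; omega)
        (fun a ha => hc a (by simp at ha ⊢; tauto)) (fun a => by
          have := he a
          simp only [List.count_cons, List.count_append] at this ⊢
          split_ifs at this <;> simp only [Nat.even_iff] at this ⊢ <;> omega)
      obtain ⟨⟨j, hj⟩, h2⟩ := h1
      have hlen : (e :: (s ++ e :: t)).length = 2 * (j + 1) := by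
        simp at hj ⊢; omega
      refine ⟨by rw [hlen]; exact even_two_mul _, ?_⟩
      rw [hlen, show q * (2 * (j + 1)) / 2 = q + q * j by
        rw [show q * (2 * (j + 1)) = 2 * (q + q * j) by ring]; simp]
      rw [hj, show q * (j + j) / 2 = q * j by
        rw [show q * (j + j) = 2 * (q * j) by ring]; simp] at h2
      rw [List.map_cons, List.map_append, List.map_cons, List.prod_cons, List.prod_append,
        List.prod_cons]
      have h3 : SgnComm (psiSet q e : Cliff N) (s.map (psiSet q)).prod := by
        refine SgnComm.list_prod_right fun b hb => ?_
        obtain ⟨i, _, rfl⟩ := List.mem_map.mp hb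
        exact sgnComm_psiSet q e i
      refine (h3.mul_mul_mul _).trans ?_
      rw [List.map_append, List.prod_append] at h2
      refine ((psiSet_mul_self (hc e (by simp))).mul h2).trans (Or.inl ?_)
      rw [smul_mul_smul_comm, one_mul, pow_add, mul_inv]

lemma count_ofFn {α : Type*} [DecidableEq α] {m : ℕ} (f : Fin m → α) (e : α) :
    (List.ofFn f).count e = (Finset.univ.filter (fun i => f i = e)).card := by
  induction m with
  | zero => simp
  | succ m ih =>
    rw [List.ofFn_succ, List.count_cons, ih, Fin.card_filter_univ_succ]
    by_cases h : f 0 = e <;> simp [h]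

/-- `r` is a `q`-uniform multiplicity function with even multiplicities. -/
def Adm (q : ℕ) (r : Finset (Fin N) → ℕ) : Prop := (∀ e, r e ≠ 0 → e.card = q) ∧ ∀ e, Even (r e)

lemma seqSum_psiSet {q : ℕ} {r : Finset (Fin N) → ℕ} (hr : Adm q r) (m : ℕ) :
    seqSum (psiSet q : Finset (Fin N) → Cliff N) r m
      = ((bMulti q r m : ℂ) * ((2 : ℂ) ^ (q * m / 2))⁻¹) • (1 : Cliff N) := by
  rw [seqSum, bMulti, Complex.ofReal_sum, Finset.sum_mul, Finset.sum_smul]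
  refine Finset.sum_congr rfl fun f _ => ?_
  by_cases h : ∀ e, (Finset.univ.filter (fun i => f i = e)).card = r e
  · rw [if_pos (by convert h), if_pos (by convert h)]
    have hcount : ∀ e, (List.ofFn f).count e = r e := fun e => by
      rw [count_ofFn]; convert h e
    have := (prod_psiSet_of_even q m (List.ofFn f) (by simp) (fun e he => hr.1 e (by
      rw [← hcount]
      exact (List.count_pos_iff.mpr he).ne')) (fun e => by rw [hcount]; exact hr.2 e)).2
    rw [List.map_ofFn, List.length_ofFn] at this
    rw [signB, List.map_ofFn, List.length_ofFn]
    have e1 : (fun i => psiSet q (f i) : Fin m → Cliff N) = psiSet q ∘ f := rfl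
    rw [e1]
    split_ifs with h'
    · rw [h']; simp
    · rcases this with this | this
      · exact absurd this h'
      · rw [this]; simp
  · rw [if_neg (fun h' => h (by convert h')), if_neg (fun h' => h (by convert h'))]
    simp

lemma abs_bMulti_le (q : ℕ) (r : Finset (Fin N) → ℕ) (m : ℕ) :
    |bMulti q r m| ≤ seqSum (fun _ => (1 : ℝ)) r m := by
  refine (Finset.abs_sum_le_sum_abs _ _).trans (Finset.sum_le_sum fun f _ => ?_)
  by_cases h : ∀ e, (Finset.univ.filter (fun i => f i = e)).card = r e
  · rw [if_pos (by convert h), if_pos (by convert h), signB]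
    split_ifs <;> simp
  · rw [if_neg (fun h' => h (by convert h')), if_neg (fun h' => h (by convert h'))]
    simp

end Clifford

section Majorana

/-- Iterated Kronecker product of `2 × 2` matrices. -/
def tens {m : ℕ} (A : Fin m → Matrix (Fin 2) (Fin 2) ℂ) :
    Matrix (Fin m → Fin 2) (Fin m → Fin 2) ℂ :=
  fun a b => ∏ k, A k (a k) (b k)

lemma tens_mul {m : ℕ} (A B : Fin m → Matrix (Fin 2) (Fin 2) ℂ) :
    tens A * tens B = tens fun k => A k * B k := by
  ext a b
  simp only [tens, Matrix.mul_apply, ← Finset.prod_mul_distrib]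
  rw [Finset.prod_univ_sum, Fintype.piFinset_univ]

lemma tens_one {m : ℕ} : tens (fun _ : Fin m => (1 : Matrix (Fin 2) (Fin 2) ℂ)) = 1 := by
  ext a b
  simp only [tens, Matrix.one_apply]
  by_cases h : a = b
  · subst h; simp
  · obtain ⟨k, hk⟩ := Function.ne_iff.mp h
    rw [if_neg h]
    exact Finset.prod_eq_zero (Finset.mem_univ k) (by simp [hk])

lemma tens_smul {m : ℕ} (s : Fin m → ℂ) (A : Fin m → Matrix (Fin 2) (Fin 2) ℂ) :
    tens (fun k => s k • A k) = (∏ k, s k) • tens A := by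
  ext a b
  simp [tens, Finset.prod_mul_distrib]

/-- The Kronecker factor of the `i`-th Majorana matrix at site `k`. -/
def siteFactor (i k : ℕ) : Matrix (Fin 2) (Fin 2) ℂ :=
  if k < i / 2 then pZ else if k = i / 2 then (if i % 2 = 0 then pX else pY) else 1

lemma psiM_eq {m : ℕ} (i : Fin (2 * m)) :
    psiM m i = ((Real.sqrt 2 : ℝ) : ℂ)⁻¹ • tens fun k : Fin m => siteFactor i k := by
  ext a b
  simp only [psiM, tens, Matrix.smul_apply, smul_eq_mul]
  congr 1
  refine Finset.prod_congr rfl fun k _ => ?_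
  unfold siteFactor
  split_ifs <;> simp_all [Matrix.one_apply]

lemma pZ_mul_pX : pZ * pX = -(pX * pZ) := by
  ext a b; fin_cases a <;> fin_cases b <;> simp [pZ, pX]

lemma pZ_mul_pY : pZ * pY = -(pY * pZ) := by
  ext a b; fin_cases a <;> fin_cases b <;> simp [pZ, pY]

lemma pX_mul_pY : pX * pY = -(pY * pX) := by
  ext a b; fin_cases a <;> fin_cases b <;> simp [pX, pY]

lemma pX_mul_self : pX * pX = 1 := by
  ext a b; fin_cases a <;> fin_cases b <;> simp [pX]

lemma pY_mul_self : pY * pY = 1 := by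
  ext a b; fin_cases a <;> fin_cases b <;> simp [pY]

lemma pZ_mul_self : pZ * pZ = 1 := by
  ext a b; fin_cases a <;> fin_cases b <;> simp [pZ]

lemma siteFactor_mul_self (i k : ℕ) : siteFactor i k * siteFactor i k = 1 := by
  unfold siteFactor
  split_ifs <;> simp [pX_mul_self, pY_mul_self, pZ_mul_self]

lemma siteFactor_anticomm {i j : ℕ} (h : i < j) (k : ℕ) :
    siteFactor i k * siteFactor j k
      = (if k = i / 2 then (-1 : ℂ) else 1) • (siteFactor j k * siteFactor i k) := by
  unfold siteFactor
  split_ifs <;> first | omega | simp [pZ_mul_pX, pZ_mul_pY, pX_mul_pY]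

lemma psiM_anticomm {m : ℕ} {i j : Fin (2 * m)} (h : i < j) :
    psiM m i * psiM m j = -(psiM m j * psiM m i) := by
  simp only [psiM_eq, smul_mul_smul_comm, tens_mul]
  rw [show (fun k : Fin m => siteFactor i k * siteFactor j k)
      = fun k : Fin m => (if (k : ℕ) = (i : ℕ) / 2 then (-1 : ℂ) else 1) •
        (siteFactor j k * siteFactor i k) from funext fun k => siteFactor_anticomm h k, tens_smul]
  have hi : (i : ℕ) / 2 < m := by omega
  have : ∏ k : Fin m, (if (k : ℕ) = (i : ℕ) / 2 then (-1 : ℂ) else 1) = -1 := by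
    rw [Finset.prod_eq_single (⟨(i : ℕ) / 2, hi⟩ : Fin m)]
    · simp
    · intro b _ hb
      rw [if_neg]
      intro h'
      exact hb (Fin.ext h')
    · simp
  rw [this]
  simp

lemma psiM_majorana {m : ℕ} (i j : Fin (2 * m)) :
    psiM m i * psiM m j + psiM m j * psiM m i = if i = j then 1 else 0 := by
  rcases lt_trichotomy i j with h | h | h
  · rw [psiM_anticomm h, if_neg h.ne]; simp
  · subst h
    rw [if_pos rfl, psiM_eq, smul_mul_smul_comm, tens_mul]
    simp only [siteFactor_mul_self, tens_one]
    rw [← add_smul, ← mul_inv, ← Complex.ofReal_mul, Real.mul_self_sqrt (by norm_num)]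
    norm_num
  · rw [psiM_anticomm h, if_neg h.ne']; simp

lemma map_psiSet {N : ℕ} {A : Type*} [Ring A] [Algebra ℂ A] (Φ : Cliff N →ₐ[ℂ] A) (q : ℕ)
    (I : Finset (Fin N)) :
    Φ (psiSet q I) = Complex.I ^ (q / 2) • ((I.sort (· ≤ ·)).map fun i => Φ (psi i)).prod := by
  rw [psiSet, map_smul, map_list_prod, List.map_map]
  rfl

lemma exists_algHom_psiM (m q : ℕ) :
    ∃ Φ : Cliff (2 * m) →ₐ[ℂ] Matrix (Fin m → Fin 2) (Fin m → Fin 2) ℂ,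
      ∀ I, Φ (psiSet q I) = psiMSet m q I := by
  obtain ⟨Φ, hΦ⟩ := exists_algHom_of_majorana (psiM m) (fun i j => by
    rw [psiM_majorana])
  refine ⟨Φ, fun I => ?_⟩
  rw [map_psiSet, psiMSet]
  simp only [hΦ]

/-- Relabelling the Majorana generators along an order embedding. -/
lemma exists_algHom_relabel {v n : ℕ} (φ : Fin v ↪o Fin n) (q : ℕ) :
    ∃ Φ : Cliff v →ₐ[ℂ] Cliff n, ∀ I, Φ (psiSet q I) = psiSet q (I.map φ.toEmbedding) := by
  obtain ⟨Φ, hΦ⟩ := exists_algHom_of_majorana (fun i => (psi (φ i) : Cliff n)) (fun i j => by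
    rw [psi_mul_psi_add_swap]
    simp only [φ.injective.eq_iff])
  refine ⟨Φ, fun I => ?_⟩
  rw [map_psiSet, psiSet]
  simp only [hΦ]
  have : (I.map φ.toEmbedding).sort (· ≤ ·) = (I.sort (· ≤ ·)).map φ := by
    exact (StrictMonoOn.map_finsetSort φ.toEmbedding I (φ.strictMono.strictMonoOn _)).symm
  rw [this, List.map_map]
  rfl

end Majorana

section ClusterExpansion

variable {N : ℕ}

/-- The weight of a multi-hypergraph with multiplicity function `r`. -/
def gam (q : ℕ) (x : ℝ) (r : Finset (Fin N) → ℕ) : ℝ :=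
  x ^ (∑ e, r e) * bMulti q r (∑ e, r e) / (∑ e, r e).factorial

lemma abs_gam_le (q : ℕ) (x : ℝ) (r : Finset (Fin N) → ℕ) :
    |gam q x r| ≤ |x| ^ (∑ e, r e) / (∑ e, r e).factorial
      * seqSum (fun _ => (1 : ℝ)) r (∑ e, r e) := by
  rw [gam, abs_div, abs_mul, abs_pow, Nat.abs_cast, div_mul_eq_mul_div]
  gcongr
  exact abs_bMulti_le q r _

lemma summable_gam (q : ℕ) (x : ℝ) : Summable (gam (N := N) q x) := by
  set c : ℝ := ∑ _e : Finset (Fin N), (1 : ℝ) with hc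
  have hc0 : 0 ≤ c := Finset.sum_nonneg fun _ _ => zero_le_one
  refine Summable.of_abs (summable_of_sum_le (c := Real.exp (|x| * c))
    (fun _ => abs_nonneg _) fun F => ?_)
  obtain ⟨M, hM⟩ := (F.image fun r => ∑ e, r e).exists_nat_subset_range
  calc ∑ r ∈ F, |gam q x r|
      ≤ ∑ r ∈ F, |x| ^ (∑ e, r e) / (∑ e, r e).factorial
          * seqSum (fun _ => (1 : ℝ)) r (∑ e, r e) :=
        Finset.sum_le_sum fun r _ => abs_gam_le q x r
    _ = ∑ m ∈ Finset.range M, ∑ r ∈ F with ∑ e, r e = m, |x| ^ (∑ e, r e) /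
          (∑ e, r e).factorial * seqSum (fun _ => (1 : ℝ)) r (∑ e, r e) :=
        (Finset.sum_fiberwise_of_maps_to
          (fun r hr => hM (Finset.mem_image_of_mem _ hr)) _).symm
    _ ≤ ∑ m ∈ Finset.range M, (|x| * c) ^ m / m.factorial := by
        refine Finset.sum_le_sum fun m _ => ?_
        have : ∑ r ∈ F with ∑ e, r e = m, |x| ^ (∑ e, r e) /
            (∑ e, r e).factorial * seqSum (fun _ => (1 : ℝ)) r (∑ e, r e)
            = |x| ^ m / m.factorial *
              ∑ r ∈ F with ∑ e, r e = m, seqSum (fun _ => (1 : ℝ)) r m := by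
          rw [Finset.mul_sum]
          refine Finset.sum_congr rfl fun r hr => ?_
          rw [(Finset.mem_filter.mp hr).2]
        rw [this, mul_pow, mul_div_right_comm]
        gcongr
        exact sum_seqSum_le _ (fun _ => zero_le_one) _ m
    _ ≤ Real.exp (|x| * c) := Real.sum_le_exp_of_nonneg (by positivity) M

lemma summable_ite_gam (q : ℕ) (x : ℝ) (P : (Finset (Fin N) → ℕ) → Prop)
    [DecidablePred P] : Summable fun r => if P r then gam q x r else 0 := by
  have := (summable_gam (N := N) q x).indicator {r | P r}
  refine this.congr fun r => ?_
  by_cases hr : P r <;> simp [hr]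

lemma gam_add {q : ℕ} (hq : Even q) (hq2 : 2 ≤ q) (x : ℝ) {r₁ r₂ : Finset (Fin N) → ℕ}
    (h₁ : Adm q r₁) (h₂ : Adm q r₂) (h₁₂ : Adm q (r₁ + r₂))
    (hd : ∀ e e', r₁ e ≠ 0 → r₂ e' ≠ 0 → Disjoint e e') :
    gam q x (r₁ + r₂) = gam q x r₁ * gam q x r₂ := by
  obtain ⟨m₁, hm₁⟩ : ∃ m, ∑ e, r₁ e = m := ⟨_, rfl⟩
  obtain ⟨m₂, hm₂⟩ : ∃ m, ∑ e, r₂ e = m := ⟨_, rfl⟩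
  have hm : ∑ e, (r₁ + r₂) e = m₁ + m₂ := by
    simp [Finset.sum_add_distrib, hm₁, hm₂]
  obtain ⟨k₁, hk₁⟩ : Even m₁ := hm₁ ▸ Finset.even_sum _ fun e _ => h₁.2 e
  obtain ⟨k₂, hk₂⟩ : Even m₂ := hm₂ ▸ Finset.even_sum _ fun e _ => h₂.2 e
  have hsupp : ∀ e, r₁ e = 0 ∨ r₂ e = 0 := by
    intro e
    by_contra! h
    have := hd e e h.1 h.2
    rw [disjoint_self, Finset.bot_eq_empty] at this
    have h' := h₁.1 e h.1
    rw [this, Finset.card_empty] at h'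
    omega
  have key := seqSum_add (psiSet q : Finset (Fin N) → Cliff N) m₁ m₂ r₁ r₂ hm₁ hm₂ hsupp
    (fun e e' he he' => commute_psiSet hq (h₂.1 e' he') (hd e e' he he'))
  rw [seqSum_psiSet h₁, seqSum_psiSet h₂, seqSum_psiSet h₁₂, smul_mul_smul_comm, one_mul,
    ← Algebra.algebraMap_eq_smul_one, ← Algebra.algebraMap_eq_smul_one,
    ← map_natCast (algebraMap ℂ (Cliff N)), ← map_mul] at key
  have key2 := algebraMap_cliff_injective key
  have e1 : q * m₁ / 2 = q * k₁ := by
    rw [hk₁, show q * (k₁ + k₁) = 2 * (q * k₁) by ring]; simp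
  have e2 : q * m₂ / 2 = q * k₂ := by
    rw [hk₂, show q * (k₂ + k₂) = 2 * (q * k₂) by ring]; simp
  have e3 : q * (m₁ + m₂) / 2 = q * k₁ + q * k₂ := by
    rw [hk₁, hk₂, show q * (k₁ + k₁ + (k₂ + k₂)) = 2 * (q * k₁ + q * k₂) by ring]; simp
  rw [e1, e2, e3, pow_add] at key2
  have hb : bMulti q (r₁ + r₂) (m₁ + m₂)
      = ((m₁ + m₂).choose m₁ : ℝ) * (bMulti q r₁ m₁ * bMulti q r₂ m₂) := by
    have h2 : ∀ k : ℕ, (2 : ℂ) ^ k ≠ 0 := fun k => pow_ne_zero _ two_ne_zero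
    have : (bMulti q (r₁ + r₂) (m₁ + m₂) : ℂ)
        = ((m₁ + m₂).choose m₁ : ℂ) * (bMulti q r₁ m₁ * bMulti q r₂ m₂) := by
      have h3 := h2 (q * k₁)
      have h4 := h2 (q * k₂)
      field_simp at key2
      rw [key2]; ring
    exact_mod_cast this
  have hf : ((m₁ + m₂).choose m₁ : ℝ) * m₁.factorial * m₂.factorial = (m₁ + m₂).factorial := by
    rw [Nat.choose_symm_add]
    exact_mod_cast Nat.add_choose_mul_factorial_mul_factorial m₁ m₂
  rw [gam, gam, gam, hm, hm₁, hm₂, hb, pow_add, ← hf]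
  have f1 : (m₁.factorial : ℝ) ≠ 0 := by positivity
  have f2 : (m₂.factorial : ℝ) ≠ 0 := by positivity
  have f3 : ((m₁ + m₂).choose m₁ : ℝ) ≠ 0 := by
    exact_mod_cast (Nat.choose_pos (Nat.le_add_right m₁ m₂)).ne'
  field_simp

/-- All hyperedges of `r` are contained in `S`. -/
def SuppIn (S : Finset (Fin N)) (r : Finset (Fin N) → ℕ) : Prop := ∀ e, r e ≠ 0 → e ⊆ S

/-- Two vertices are adjacent if they lie on a common hyperedge. -/
def HAdj (r : Finset (Fin N) → ℕ) (a b : Fin N) : Prop := ∃ e, r e ≠ 0 ∧ a ∈ e ∧ b ∈ e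

/-- All vertices of `U` are joined in `r`. -/
def Joined (U : Finset (Fin N)) (r : Finset (Fin N) → ℕ) : Prop :=
  ∀ a ∈ U, ∀ b ∈ U, Relation.ReflTransGen (HAdj r) a b

/-- The vertex set of the connected component of `a`. -/
def vertexComp (r : Finset (Fin N) → ℕ) (a : Fin N) : Finset (Fin N) :=
  Finset.univ.filter fun b => Relation.ReflTransGen (HAdj r) a b

lemma mem_vertexComp {r : Finset (Fin N) → ℕ} {a b : Fin N} :
    b ∈ vertexComp r a ↔ Relation.ReflTransGen (HAdj r) a b := by
  simp [vertexComp]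

lemma HAdj.symm {r : Finset (Fin N) → ℕ} {a b : Fin N} (h : HAdj r a b) : HAdj r b a := by
  obtain ⟨e, h1, h2, h3⟩ := h
  exact ⟨e, h1, h3, h2⟩

lemma reflTransGen_hAdj_symm {r : Finset (Fin N) → ℕ} {a b : Fin N}
    (h : Relation.ReflTransGen (HAdj r) a b) : Relation.ReflTransGen (HAdj r) b a := by
  induction h with
  | refl => exact Relation.ReflTransGen.refl
  | tail _ h ih => exact (Relation.ReflTransGen.single h.symm).trans ih

/-- A set closed under adjacency contains the component of each of its points. -/
lemma mem_of_reflTransGen {r : Finset (Fin N) → ℕ} {U : Finset (Fin N)} {a b : Fin N}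
    (ha : a ∈ U) (hU : ∀ e, r e ≠ 0 → ∀ c ∈ e, c ∈ U → e ⊆ U)
    (h : Relation.ReflTransGen (HAdj r) a b) : b ∈ U := by
  induction h with
  | refl => exact ha
  | tail _ h ih =>
    obtain ⟨e, he, h1, h2⟩ := h
    exact hU e he _ h1 ih h2

/-- Total weight of the multi-hypergraphs supported in `S`. -/
def totalW (q : ℕ) (x : ℝ) (S : Finset (Fin N)) : ℝ :=
  ∑' r : Finset (Fin N) → ℕ, if Adm q r ∧ SuppIn S r then gam q x r else 0

/-- Total weight of the connected multi-hypergraphs on `U`. -/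
def connW (q : ℕ) (x : ℝ) (U : Finset (Fin N)) : ℝ :=
  ∑' r : Finset (Fin N) → ℕ, if Adm q r ∧ SuppIn U r ∧ Joined U r then gam q x r else 0

lemma Adm.add {q : ℕ} {r₁ r₂ : Finset (Fin N) → ℕ} (h₁ : Adm q r₁) (h₂ : Adm q r₂) :
    Adm q (r₁ + r₂) := by
  refine ⟨fun e he => ?_, fun e => (h₁.2 e).add (h₂.2 e)⟩
  by_cases h : r₁ e = 0
  · exact h₂.1 e (by simpa [h] using he)
  · exact h₁.1 e h

lemma tsum_vertexComp_eq {q : ℕ} (hq : Even q) (hq2 : 2 ≤ q) (x : ℝ) {S U : Finset (Fin N)}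
    {a : Fin N} (ha : a ∈ U) (hU : U ⊆ S) :
    (∑' r : Finset (Fin N) → ℕ,
      if (Adm q r ∧ SuppIn S r) ∧ vertexComp r a = U then gam q x r else 0)
      = connW q x U * totalW q x (S \ U) := by
  have hne : ∀ {e : Finset (Fin N)}, e.card = q → e ⊆ U → e ⊆ S \ U → False := by
    intro e h1 h2 h3
    have : e = ∅ := by
      refine Finset.eq_empty_of_forall_notMem fun b hb => ?_
      exact (Finset.mem_sdiff.mp (h3 hb)).2 (h2 hb)
    rw [this, Finset.card_empty] at h1
    omega
  rw [connW, totalW, tsum_mul_tsum_of_summable_norm (summable_ite_gam q x _).norm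
    (summable_ite_gam q x _).norm]
  have hsp : ∀ p : (Finset (Fin N) → ℕ) × (Finset (Fin N) → ℕ),
      (if Adm q p.1 ∧ SuppIn U p.1 ∧ Joined U p.1 then gam q x p.1 else 0) *
        (if Adm q p.2 ∧ SuppIn (S \ U) p.2 then gam q x p.2 else 0) ≠ 0 →
      (Adm q p.1 ∧ SuppIn U p.1 ∧ Joined U p.1) ∧ (Adm q p.2 ∧ SuppIn (S \ U) p.2) := by
    intro p hp
    by_contra h
    apply hp
    rw [not_and_or] at h
    rcases h with h | h <;> simp [h]
  refine tsum_eq_tsum_of_ne_zero_bij (fun p => p.1.1 + p.1.2) ?_ ?_ ?_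
  · rintro ⟨⟨r₁, r₂⟩, hr⟩ ⟨⟨s₁, s₂⟩, hs⟩ heq
    obtain ⟨⟨hr1, hr2, -⟩, hr3, hr4⟩ := hsp _ hr
    obtain ⟨⟨hs1, hs2, -⟩, hs3, hs4⟩ := hsp _ hs
    simp only at hr1 hr2 hr3 hr4 hs1 hs2 hs3 hs4 heq
    have key : ∀ e, r₁ e = s₁ e ∧ r₂ e = s₂ e := by
      intro e
      have he := congrFun heq e
      simp only [Pi.add_apply] at he
      have a1 : ¬ (r₁ e ≠ 0 ∧ r₂ e ≠ 0) := fun h => hne (hr1.1 e h.1) (hr2 e h.1) (hr4 e h.2)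
      have a2 : ¬ (r₁ e ≠ 0 ∧ s₂ e ≠ 0) := fun h => hne (hr1.1 e h.1) (hr2 e h.1) (hs4 e h.2)
      have a3 : ¬ (s₁ e ≠ 0 ∧ r₂ e ≠ 0) := fun h => hne (hs1.1 e h.1) (hs2 e h.1) (hr4 e h.2)
      have a4 : ¬ (s₁ e ≠ 0 ∧ s₂ e ≠ 0) := fun h => hne (hs1.1 e h.1) (hs2 e h.1) (hs4 e h.2)
      omega
    have h1 : r₁ = s₁ := funext fun e => (key e).1
    have h2 : r₂ = s₂ := funext fun e => (key e).2
    subst h1 h2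
    rfl
  · intro r hr
    have hr' : (Adm q r ∧ SuppIn S r) ∧ vertexComp r a = U := by
      by_contra h
      exact hr (by simp [h])
    obtain ⟨⟨hA, hS⟩, hcomp⟩ := hr'
    have hmem : ∀ b, b ∈ U ↔ Relation.ReflTransGen (HAdj r) a b := fun b => by
      rw [← hcomp, mem_vertexComp]
    have hclosed : ∀ e, r e ≠ 0 → ∀ c ∈ e, c ∈ U → e ⊆ U := by
      intro e he c hce hcU b hb
      exact (hmem b).2 (((hmem c).1 hcU).tail ⟨e, he, hce, hb⟩)
    set r₁ : Finset (Fin N) → ℕ := fun e => if e ⊆ U then r e else 0 with hr₁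
    set r₂ : Finset (Fin N) → ℕ := fun e => if e ⊆ U then 0 else r e with hr₂
    have hadd : r₁ + r₂ = r := by
      funext e
      by_cases he : e ⊆ U <;> simp [hr₁, hr₂, he]
    have h1 : Adm q r₁ := by
      refine ⟨fun e he => ?_, fun e => ?_⟩
      · by_cases h : e ⊆ U
        · exact hA.1 e (by simpa [hr₁, h] using he)
        · simp [hr₁, h] at he
      · by_cases h : e ⊆ U <;> simp [hr₁, h, hA.2 e]
    have h2 : Adm q r₂ := by
      refine ⟨fun e he => ?_, fun e => ?_⟩
      · by_cases h : e ⊆ U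
        · simp [hr₂, h] at he
        · exact hA.1 e (by simpa [hr₂, h] using he)
      · by_cases h : e ⊆ U <;> simp [hr₂, h, hA.2 e]
    have h3 : SuppIn U r₁ := by
      intro e he
      by_contra h
      simp [hr₁, h] at he
    have h4 : SuppIn (S \ U) r₂ := by
      intro e he b hb
      by_cases h : e ⊆ U
      · simp [hr₂, h] at he
      · have he' : r e ≠ 0 := by simpa [hr₂, h] using he
        exact Finset.mem_sdiff.mpr ⟨hS e he' hb, fun hbU => h (hclosed e he' b hb hbU)⟩
    have h5 : ∀ b, Relation.ReflTransGen (HAdj r) a b → Relation.ReflTransGen (HAdj r₁) a b := by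
      intro b hb
      induction hb with
      | refl => exact Relation.ReflTransGen.refl
      | @tail c d hc hd ih =>
        obtain ⟨e, he, hce, hde⟩ := hd
        refine ih.tail ⟨e, ?_, hce, hde⟩
        simpa [hr₁, hclosed e he c hce ((hmem c).2 hc)] using he
    have h6 : Joined U r₁ := fun b hb c hc =>
      (reflTransGen_hAdj_symm (h5 b ((hmem b).1 hb))).trans (h5 c ((hmem c).1 hc))
    have hg := gam_add hq hq2 x h1 h2 (h1.add h2) (fun e e' he he' =>
      Finset.disjoint_of_subset_left (h3 e he)
        (Finset.disjoint_of_subset_right (h4 e' he') Finset.disjoint_sdiff))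
    refine ⟨⟨(r₁, r₂), ?_⟩, hadd⟩
    rw [Function.mem_support, if_pos ⟨h1, h3, h6⟩, if_pos ⟨h2, h4⟩, ← hg, hadd]
    intro h0
    exact hr (by simp [h0])
  · rintro ⟨⟨r₁, r₂⟩, hr⟩
    obtain ⟨⟨h1, h3, h6⟩, h2, h4⟩ := hsp _ hr
    simp only at h1 h2 h3 h4 h6 ⊢
    rw [if_pos (show Adm q r₁ ∧ SuppIn U r₁ ∧ Joined U r₁ from ⟨h1, h3, h6⟩),
      if_pos (show Adm q r₂ ∧ SuppIn (S \ U) r₂ from ⟨h2, h4⟩),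
      ← gam_add hq hq2 x h1 h2 (h1.add h2)
      (fun e e' he he' => Finset.disjoint_of_subset_left (h3 e he)
        (Finset.disjoint_of_subset_right (h4 e' he') Finset.disjoint_sdiff)), if_pos]
    have hcases : ∀ e, (r₁ + r₂) e ≠ 0 → e ⊆ U ∨ e ⊆ S \ U := by
      intro e he
      by_cases h : r₁ e = 0
      · exact Or.inr (h4 e (by simpa [h] using he))
      · exact Or.inl (h3 e h)
    refine ⟨⟨h1.add h2, fun e he => ?_⟩, ?_⟩
    · rcases hcases e he with h | h
      · exact h.trans hU
      · exact h.trans Finset.sdiff_subset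
    · ext b
      rw [mem_vertexComp]
      constructor
      · refine mem_of_reflTransGen ha fun e he c hce hcU => ?_
        rcases hcases e he with h | h
        · exact h
        · exact absurd hcU (Finset.mem_sdiff.mp (h hce)).2
      · intro hb
        refine Relation.ReflTransGen.mono (r := HAdj r₁) (fun c d => ?_) _ _ (h6 a ha b hb)
        rintro ⟨e, he, h⟩
        exact ⟨e, by simp [he], h⟩

/-- Summing over the component of a marked vertex. -/
lemma totalW_eq_sum {q : ℕ} (hq : Even q) (hq2 : 2 ≤ q) (x : ℝ) {S : Finset (Fin N)}
    {a : Fin N} (ha : a ∈ S) :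
    totalW q x S = ∑ U ∈ S.powerset with a ∈ U, connW q x U * totalW q x (S \ U) := by
  have h1 : ∀ r : Finset (Fin N) → ℕ, (if Adm q r ∧ SuppIn S r then gam q x r else 0)
      = ∑ U ∈ S.powerset with a ∈ U,
        if (Adm q r ∧ SuppIn S r) ∧ vertexComp r a = U then gam q x r else 0 := by
    intro r
    by_cases h : Adm q r ∧ SuppIn S r
    · simp only [h, true_and, and_self, if_true]
      rw [Finset.sum_ite_eq, if_pos]
      simp only [Finset.mem_filter, Finset.mem_powerset, mem_vertexComp]
      refine ⟨fun b hb => ?_, Relation.ReflTransGen.refl⟩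
      exact mem_of_reflTransGen ha (fun e he _ _ _ => h.2 e he) (mem_vertexComp.mp hb)
    · simp [h]
  rw [totalW, tsum_congr h1, Summable.tsum_finsetSum fun U _ => summable_ite_gam q x _]
  refine Finset.sum_congr rfl fun U hU => ?_
  simp only [Finset.mem_filter, Finset.mem_powerset] at hU
  exact tsum_vertexComp_eq hq hq2 x hU.2 hU.1

lemma seqSum_zero_zero {A : Type*} [Semiring A] {ι : Type*} [Fintype ι] (g : ι → A) :
    seqSum g 0 0 = 1 := by
  rw [seqSum_zero_right, if_pos rfl]

lemma bMulti_zero (q : ℕ) : bMulti q (0 : Finset (Fin N) → ℕ) 0 = 1 := by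
  have h := seqSum_psiSet (N := N) (q := q) (r := 0) ⟨by simp, by simp⟩ 0
  rw [seqSum_zero_zero, ← Algebra.algebraMap_eq_smul_one, ← map_one (algebraMap ℂ (Cliff N))] at h
  have := algebraMap_cliff_injective h
  simp at this
  exact_mod_cast this.symm

lemma totalW_empty {q : ℕ} (hq2 : 2 ≤ q) (x : ℝ) : totalW q x (∅ : Finset (Fin N)) = 1 := by
  rw [totalW, tsum_eq_single 0]
  · rw [if_pos]
    · simp [gam, bMulti_zero]
    · exact ⟨⟨by simp, by simp⟩, fun e he => by simp at he⟩
  · intro r hr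
    rw [if_neg]
    rintro ⟨h1, h2⟩
    apply hr
    funext e
    by_contra he
    have h3 := h1.1 e he
    rw [Finset.subset_empty.mp (h2 e he), Finset.card_empty] at h3
    omega

end ClusterExpansion

section Relabel

variable {v N : ℕ}

/-- Transport of multiplicities along an order embedding of the vertices. -/
def push (φ : Fin v ↪o Fin N) (r : Finset (Fin v) → ℕ) : Finset (Fin N) → ℕ :=
  Function.extend (Finset.map φ.toEmbedding) r 0

lemma push_map (φ : Fin v ↪o Fin N) (r : Finset (Fin v) → ℕ) (e : Finset (Fin v)) :
    push φ r (e.map φ.toEmbedding) = r e :=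
  (Finset.map_injective _).extend_apply _ _ _

lemma exists_of_push_ne_zero {φ : Fin v ↪o Fin N} {r : Finset (Fin v) → ℕ}
    {e : Finset (Fin N)} (h : push φ r e ≠ 0) :
    ∃ e', Finset.map φ.toEmbedding e' = e ∧ r e' ≠ 0 := by
  by_cases he : ∃ e', Finset.map φ.toEmbedding e' = e
  · obtain ⟨e', rfl⟩ := he
    exact ⟨e', rfl, by rwa [push_map] at h⟩
  · rw [push, Function.extend_apply' _ _ _ he] at h
    exact absurd rfl h

lemma push_injective (φ : Fin v ↪o Fin N) : Function.Injective (push φ) := fun r s h =>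
  funext fun e => by rw [← push_map φ r, h, push_map]

lemma adm_push {q : ℕ} {φ : Fin v ↪o Fin N} {r : Finset (Fin v) → ℕ} :
    Adm q (push φ r) ↔ Adm q r := by
  constructor
  · rintro ⟨h1, h2⟩
    refine ⟨fun e he => ?_, fun e => ?_⟩
    · rw [← h1 (e.map φ.toEmbedding) (by rwa [push_map]), Finset.card_map]
    · rw [← push_map φ r]; exact h2 _
  · rintro ⟨h1, h2⟩
    refine ⟨fun e he => ?_, fun e => ?_⟩
    · obtain ⟨e', rfl, he'⟩ := exists_of_push_ne_zero he
      rw [Finset.card_map, h1 e' he']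
    · by_cases he : push φ r e = 0
      · rw [he]; exact Even.zero
      · obtain ⟨e', rfl, he'⟩ := exists_of_push_ne_zero he
        rw [push_map]; exact h2 e'

lemma sum_push (φ : Fin v ↪o Fin N) (r : Finset (Fin v) → ℕ) :
    ∑ e, push φ r e = ∑ e, r e := by
  refine (Fintype.sum_of_injective (Finset.map φ.toEmbedding) (Finset.map_injective _) _ _
    (fun e he => ?_) fun e => (push_map φ r e).symm).symm
  by_contra h
  obtain ⟨e', h1, -⟩ := exists_of_push_ne_zero h
  exact he ⟨e', h1⟩

lemma bMulti_push {q : ℕ} {φ : Fin v ↪o Fin N} {r : Finset (Fin v) → ℕ} (hr : Adm q r)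
    (m : ℕ) : bMulti q (push φ r) m = bMulti q r m := by
  obtain ⟨Φ, hΦ⟩ := exists_algHom_relabel φ q
  have h1 := seqSum_psiSet (adm_push (φ := φ).mpr hr) m
  rw [push, seqSum_extend (Finset.map_injective _)] at h1
  have h2 := congrArg Φ (seqSum_psiSet hr m)
  have h3 := map_seqSum Φ.toRingHom (psiSet q : Finset (Fin v) → Cliff v) r m
  simp only [AlgHom.toRingHom_eq_coe, RingHom.coe_coe, hΦ] at h3
  rw [h3, h1, map_smul, map_one, ← Algebra.algebraMap_eq_smul_one,
    ← Algebra.algebraMap_eq_smul_one] at h2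
  have h4 := algebraMap_cliff_injective h2
  have h5 : ((2 : ℂ) ^ (q * m / 2))⁻¹ ≠ 0 := inv_ne_zero (pow_ne_zero _ two_ne_zero)
  exact_mod_cast mul_right_cancel₀ h5 h4

lemma gam_push {q : ℕ} (x : ℝ) {φ : Fin v ↪o Fin N} {r : Finset (Fin v) → ℕ}
    (hr : Adm q r) : gam q x (push φ r) = gam q x r := by
  rw [gam, gam, sum_push, bMulti_push hr]

lemma joined_push {φ : Fin v ↪o Fin N} {r : Finset (Fin v) → ℕ} :
    Joined (Finset.univ.map φ.toEmbedding) (push φ r) ↔ Joined Finset.univ r := by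
  constructor
  · intro h a _ b _
    have key : ∀ c, Relation.ReflTransGen (HAdj (push φ r)) (φ a) c →
        ∃ d, φ d = c ∧ Relation.ReflTransGen (HAdj r) a d := by
      intro c hc
      induction hc with
      | refl => exact ⟨a, rfl, Relation.ReflTransGen.refl⟩
      | tail _ hd ih =>
        obtain ⟨d, rfl, h2⟩ := ih
        obtain ⟨e, he, h3, h4⟩ := hd
        obtain ⟨e', rfl, he'⟩ := exists_of_push_ne_zero he
        obtain ⟨d', hd', rfl⟩ := Finset.mem_map.mp h4
        exact ⟨d', rfl, h2.tail ⟨e', he', by simpa using h3, hd'⟩⟩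
    obtain ⟨d, hd, h1⟩ := key (φ b) (h _ (by simp) _ (by simp))
    rwa [← φ.injective hd]
  · intro h a ha b hb
    obtain ⟨a, -, rfl⟩ := Finset.mem_map.mp ha
    obtain ⟨b, -, rfl⟩ := Finset.mem_map.mp hb
    refine Relation.ReflTransGen.lift (r := HAdj r) φ.toEmbedding (fun c d => ?_) _ _
      (h a (by simp) b (by simp))
    rintro ⟨e, he, h1, h2⟩
    exact ⟨e.map φ.toEmbedding, by rwa [push_map], by simpa using h1, by simpa using h2⟩

lemma connW_map (q : ℕ) (x : ℝ) (φ : Fin v ↪o Fin N) :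
    connW q x (Finset.univ.map φ.toEmbedding) = connW q x (Finset.univ : Finset (Fin v)) := by
  rw [connW, connW, ← (push_injective φ).tsum_eq]
  · refine tsum_congr fun r => ?_
    have h1 : SuppIn (Finset.univ.map φ.toEmbedding) (push φ r) := by
      intro e he
      obtain ⟨e', rfl, -⟩ := exists_of_push_ne_zero he
      exact Finset.map_subset_map.mpr (Finset.subset_univ _)
    have h2 : SuppIn Finset.univ r := fun e _ => Finset.subset_univ e
    by_cases h : Adm q r ∧ Joined Finset.univ r
    · rw [if_pos ⟨adm_push.mpr h.1, h1, joined_push.mpr h.2⟩, if_pos ⟨h.1, h2, h.2⟩,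
        gam_push x h.1]
    · rw [if_neg fun h' => h ⟨adm_push.mp h'.1, joined_push.mp h'.2.2⟩,
        if_neg fun h' => h ⟨h'.1, h'.2.2⟩]
  · intro r hr
    have hS : SuppIn (Finset.univ.map φ.toEmbedding) r := by
      by_contra h
      exact hr (by simp [h])
    refine ⟨fun e => r (e.map φ.toEmbedding), funext fun e => ?_⟩
    by_cases he : ∃ e', Finset.map φ.toEmbedding e' = e
    · obtain ⟨e', rfl⟩ := he
      rw [push_map]
    · rw [push, Function.extend_apply' _ _ _ he, Pi.zero_apply]
      by_contra h
      obtain ⟨e', -, h'⟩ := Finset.subset_map_iff.mp (hS e (Ne.symm h))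
      exact he ⟨e', h'.symm⟩

lemma connW_eq_of_card (q : ℕ) (x : ℝ) {U : Finset (Fin N)} (hU : U.card = v) :
    connW q x U = connW q x (Finset.univ : Finset (Fin v)) := by
  rw [← connW_map q x (U.orderEmbOfFin hU), Finset.map_orderEmbOfFin_univ]

/-- The total weight on `k` vertices, defined by the component recursion. -/
def totalRec (w : ℕ → ℝ) : ℕ → ℝ
  | 0 => 1
  | k + 1 => ∑ j : Fin (k + 1), (k.choose j : ℝ) * w (j + 1) * totalRec w (k - j)

lemma totalRec_succ (w : ℕ → ℝ) (k : ℕ) : totalRec w (k + 1)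
    = ∑ j ∈ Finset.range (k + 1), (k.choose j : ℝ) * w (j + 1) * totalRec w (k - j) := by
  rw [totalRec, Finset.sum_range]

lemma totalW_eq_totalRec {q : ℕ} (hq : Even q) (hq2 : 2 ≤ q) (x : ℝ) (k : ℕ) :
    ∀ S : Finset (Fin N), S.card = k →
      totalW q x S = totalRec (fun u => connW q x (Finset.univ : Finset (Fin u))) k := by
  induction k using Nat.strong_induction_on with
  | _ k ih =>
    intro S hS
    cases k with
    | zero => rw [Finset.card_eq_zero.mp hS, totalW_empty hq2, totalRec]
    | succ k =>
      obtain ⟨a, ha⟩ := Finset.card_pos.mp (by omega : 0 < S.card)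
      have hSe : (S.erase a).card = k := by rw [Finset.card_erase_of_mem ha, hS]; rfl
      rw [totalW_eq_sum hq hq2 x ha, totalRec_succ]
      have h1 : ∑ U ∈ S.powerset with a ∈ U, connW q x U * totalW q x (S \ U)
          = ∑ V ∈ (S.erase a).powerset,
            connW q x (insert a V) * totalW q x (S \ insert a V) := by
        refine Finset.sum_nbij' (fun U => U.erase a) (fun V => insert a V) ?_ ?_ ?_ ?_ ?_
        · intro U hU
          simp only [Finset.mem_filter, Finset.mem_powerset] at hU ⊢
          exact Finset.erase_subset_erase a hU.1
        · intro V hV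
          simp only [Finset.mem_filter, Finset.mem_powerset] at hV ⊢
          refine ⟨Finset.insert_subset ha (hV.trans (Finset.erase_subset _ _)),
            Finset.mem_insert_self _ _⟩
        · intro U hU
          exact Finset.insert_erase (Finset.mem_filter.mp hU).2
        · intro V hV
          refine Finset.erase_insert fun h => ?_
          simpa using Finset.mem_powerset.mp hV h
        · intro U hU
          simp only [Finset.insert_erase (Finset.mem_filter.mp hU).2]
      rw [h1, Finset.sum_powerset, hSe]
      refine Finset.sum_congr rfl fun j hj => ?_
      have h2 : ∀ V ∈ Finset.powersetCard j (S.erase a),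
          connW q x (insert a V) * totalW q x (S \ insert a V)
          = connW q x (Finset.univ : Finset (Fin (j + 1))) *
            totalRec (fun u => connW q x (Finset.univ : Finset (Fin u))) (k - j) := by
        intro V hV
        obtain ⟨hV1, hV2⟩ := Finset.mem_powersetCard.mp hV
        have haV : a ∉ V := fun h => by simpa using hV1 h
        have hc : (insert a V).card = j + 1 := by rw [Finset.card_insert_of_notMem haV, hV2]
        have hsub : insert a V ⊆ S := Finset.insert_subset ha (hV1.trans (Finset.erase_subset _ _))
        rw [connW_eq_of_card q x hc, ih (k - j) (by omega)]
        rw [Finset.card_sdiff_of_subset hsub, hc, hS]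
        omega
      rw [Finset.sum_congr rfl h2, Finset.sum_const, Finset.card_powersetCard, hSe, nsmul_eq_mul,
        mul_assoc]

end Relabel

section Excess

variable {v : ℕ}

/-- A connected hypergraph with `k` hyperedges of size `q` has at most `1 + (q-1) k` vertices. -/
lemma card_le_of_joined {q : ℕ} {r : Finset (Fin v) → ℕ}
    (hA : ∀ e, r e ≠ 0 → e.card = q) (hJ : Joined Finset.univ r) :
    v - 1 ≤ (q - 1) * (Finset.univ.filter fun e => r e ≠ 0).card := by
  rcases Nat.eq_zero_or_pos v with rfl | hv
  · simp
  set a : Fin v := ⟨0, hv⟩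
  let P : Finset (Finset (Fin v)) × Finset (Fin v) → Prop := fun p =>
    a ∈ p.2 ∧ p.1 ⊆ Finset.univ.filter (fun e => r e ≠ 0) ∧ (∀ e ∈ p.1, e ⊆ p.2) ∧
      p.2.card ≤ 1 + (q - 1) * p.1.card
  obtain ⟨⟨T, A⟩, hTA, hmax⟩ := Finset.exists_max_image (Finset.univ.filter P)
    (fun p => p.2.card) ⟨(∅, {a}), by simp [P]⟩
  simp only [Finset.mem_filter, Finset.mem_univ, true_and, P, and_imp, Prod.forall] at hTA hmax
  obtain ⟨ha, hT, hTe, hc⟩ := hTA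
  have hclosed : ∀ e, r e ≠ 0 → ∀ c ∈ e, c ∈ A → e ⊆ A := by
    intro e he c hce hcA
    by_contra hsub
    have heT : e ∉ T := fun h => hsub (hTe e h)
    have h1 : (e \ A).card ≤ q - 1 := by
      have h2 : (e \ A) ⊆ e.erase c := by
        intro b hb
        rw [Finset.mem_sdiff] at hb
        exact Finset.mem_erase.mpr ⟨fun h => hb.2 (h ▸ hcA), hb.1⟩
      refine (Finset.card_le_card h2).trans ?_
      rw [Finset.card_erase_of_mem hce, hA e he]
    have h3 : (A ∪ e).card = A.card + (e \ A).card := by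
      rw [← Finset.union_sdiff_self_eq_union, Finset.card_union_of_disjoint
        Finset.disjoint_sdiff]
    have h4 := hmax (insert e T) (A ∪ e) (Finset.mem_union_left _ ha)
      (Finset.insert_subset (by simpa using he) hT)
      (fun f hf => by
        rcases Finset.mem_insert.mp hf with rfl | hf
        · exact Finset.subset_union_right
        · exact (hTe f hf).trans Finset.subset_union_left)
      (by
        rw [h3, Finset.card_insert_of_notMem heT, mul_add, mul_one]
        omega)
    have h5 : (e \ A).card ≠ 0 := by
      rw [Finset.card_ne_zero, Finset.sdiff_nonempty]
      exact hsub
    omega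
  have hAu : A = Finset.univ := Finset.eq_univ_of_forall fun b =>
    mem_of_reflTransGen ha hclosed (hJ a (Finset.mem_univ _) b (Finset.mem_univ _))
  rw [hAu, Finset.card_univ, Fintype.card_fin] at hc
  have := Nat.mul_le_mul_left (q - 1) (Finset.card_le_card hT)
  omega

lemma exists_excess {q : ℕ} {r : Finset (Fin v) → ℕ}
    (hA : Adm q r) (hJ : Joined Finset.univ r) :
    (q - 1) * (∑ e, r e) = 2 * (v - 1 + ((q - 1) * (∑ e, r e) / 2 - (v - 1))) := by
  have h1 := card_le_of_joined hA.1 hJ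
  have h2 : 2 * (Finset.univ.filter fun e => r e ≠ 0).card ≤ ∑ e, r e := by
    rw [← Finset.sum_filter_ne_zero, mul_comm, ← smul_eq_mul]
    refine Finset.card_nsmul_le_sum _ _ _ fun e he => ?_
    have h3 := (Finset.mem_filter.mp he).2
    obtain ⟨k, hk⟩ := hA.2 e
    omega
  have h3 : Even ((q - 1) * ∑ e, r e) :=
    (Finset.even_sum _ fun e _ => hA.2 e).mul_left _
  obtain ⟨k, hk⟩ := h3
  have h4 := Nat.mul_le_mul_left (q - 1) h2
  rw [hk] at h4 ⊢
  have h5 : (q - 1) * (2 * (Finset.univ.filter fun e => r e ≠ 0).card)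
    = 2 * ((q - 1) * (Finset.univ.filter fun e => r e ≠ 0).card) := by ring
  omega

lemma isMultiHG_iff {q Δ : ℕ} {r : Finset (Fin v) → ℕ} : IsMultiHG q v Δ r ↔
    (Adm q r ∧ Joined Finset.univ r) ∧ (q - 1) * (∑ e, r e) = 2 * (v - 1 + Δ) := by
  constructor
  · rintro ⟨h1, h2, h3, h4⟩
    exact ⟨⟨⟨h1, h2⟩, fun a _ b _ => h3 a b⟩, h4⟩
  · rintro ⟨⟨⟨h1, h2⟩, h3⟩, h4⟩
    exact ⟨h1, h2, fun a b => h3 a (Finset.mem_univ _) b (Finset.mem_univ _), h4⟩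

/-- The common parameter `β 2^{-q/2} σ`. -/
def xpar (q n : ℕ) (β : ℝ) : ℝ := β * ((2 : ℝ) ^ (q / 2))⁻¹ * sigma q n

lemma muVD_eq_tsum {q : ℕ} (hq2 : 2 ≤ q) (n : ℕ) (β : ℝ) (v Δ : ℕ) :
    muVD q n β v Δ = (n : ℝ) ^ (v - 1) / v.factorial *
      ∑' r : Finset (Fin v) → ℕ,
        if IsMultiHG q v Δ r then gam q (xpar q n β) r else 0 := by
  have hinj : Function.Injective
      (fun (r : Finset (Fin v) → Fin (2 * (v - 1 + Δ) + 1)) (e : Finset (Fin v)) => (r e : ℕ)) :=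
    fun r s h => funext fun e => Fin.ext (congrFun h e)
  rw [muVD, ← hinj.tsum_eq, tsum_fintype]
  · refine congrArg _ (Finset.sum_congr rfl fun r _ => ?_)
    by_cases h : IsMultiHG q v Δ (fun e => (r e : ℕ))
    · rw [if_pos h, if_pos h]; rfl
    · rw [if_neg h, if_neg h]
  · intro r hr
    have h : IsMultiHG q v Δ r := by
      by_contra h
      exact hr (if_neg h)
    have hle : ∀ e, r e < 2 * (v - 1 + Δ) + 1 := by
      intro e
      have h1 : r e ≤ ∑ e, r e := Finset.single_le_sum (fun _ _ => Nat.zero_le _) (Finset.mem_univ e)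
      have h2 : 1 * ∑ e, r e ≤ (q - 1) * ∑ e, r e := Nat.mul_le_mul_right _ (by omega)
      have := h.2.2.2
      omega
    exact ⟨fun e => ⟨r e, hle e⟩, rfl⟩

lemma hasSum_muVD {q : ℕ} (hq2 : 2 ≤ q) (n : ℕ) (β : ℝ) (v : ℕ) :
    HasSum (fun Δ => muVD q n β v Δ) ((n : ℝ) ^ (v - 1) / v.factorial *
      connW q (xpar q n β) (Finset.univ : Finset (Fin v))) := by
  simp only [muVD_eq_tsum hq2]
  refine HasSum.mul_left _ ?_
  have h1 := (summable_ite_gam q (xpar q n β) (fun r : Finset (Fin v) → ℕ =>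
    Adm q r ∧ SuppIn Finset.univ r ∧ Joined Finset.univ r)).hasSum.tsum_fiberwise
      fun r => (q - 1) * (∑ e, r e) / 2 - (v - 1)
  refine h1.congr_fun fun Δ => ?_
  symm
  rw [tsum_subtype _ (fun r : Finset (Fin v) → ℕ =>
    if Adm q r ∧ SuppIn Finset.univ r ∧ Joined Finset.univ r then gam q (xpar q n β) r else 0)]
  refine tsum_congr fun r => ?_
  have hS : SuppIn Finset.univ r := fun e _ => Finset.subset_univ e
  by_cases h : Adm q r ∧ Joined Finset.univ r
  · have h2 := exists_excess h.1 h.2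
    by_cases h3 : (q - 1) * (∑ e, r e) / 2 - (v - 1) = Δ
    · rw [Set.indicator_of_mem (by simpa using h3), if_pos ⟨h.1, hS, h.2⟩,
        if_pos (isMultiHG_iff.mpr ⟨h, h3 ▸ h2⟩)]
    · rw [Set.indicator_of_notMem (by simpa using h3), if_neg]
      intro h4
      have := (isMultiHG_iff.mp h4).2
      omega
  · rw [if_neg fun h' => h (isMultiHG_iff.mp h').1]
    refine (Set.indicator_apply_eq_zero.mpr fun _ => if_neg fun h' => h ⟨h'.1, h'.2.2⟩)

end Excess

section PartitionFunction

open Matrix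

/-- The normalized trace `2^{-m} Tr`. -/
def ntr (m : ℕ) : Matrix (Fin m → Fin 2) (Fin m → Fin 2) ℂ →ₗ[ℂ] ℂ :=
  ((2 : ℂ) ^ m)⁻¹ • Matrix.traceLinearMap (Fin m → Fin 2) ℂ ℂ

lemma ntr_apply (m : ℕ) (A : Matrix (Fin m → Fin 2) (Fin m → Fin 2) ℂ) :
    ntr m A = ((2 : ℂ) ^ m)⁻¹ * A.trace := rfl

lemma ntr_one (m : ℕ) : ntr m 1 = 1 := by
  rw [ntr_apply, Matrix.trace_one]
  simp

lemma hasSum_ntr_expM {m : ℕ} (A : Matrix (Fin m → Fin 2) (Fin m → Fin 2) ℂ) :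
    HasSum (fun k : ℕ => (k.factorial : ℂ)⁻¹ * ntr m (A ^ k)) (ntr m (expM A)) := by
  have h1 : Summable fun k : ℕ => (k.factorial : ℂ)⁻¹ • A ^ k := by
    let _ : NormedRing (Matrix (Fin m → Fin 2) (Fin m → Fin 2) ℂ) := Matrix.linftyOpNormedRing
    let _ : NormedAlgebra ℂ (Matrix (Fin m → Fin 2) (Fin m → Fin 2) ℂ) :=
      Matrix.linftyOpNormedAlgebra
    exact NormedSpace.expSeries_summable' (𝕂 := ℂ) A
  have hc : Continuous (ntr m) := by
    change Continuous fun A : Matrix (Fin m → Fin 2) (Fin m → Fin 2) ℂ =>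
      ((2 : ℂ) ^ m)⁻¹ * A.trace
    exact continuous_const.mul continuous_id.matrix_trace
  have h2 := h1.hasSum.map (ntr m) hc
  refine h2.congr_fun fun k => ?_
  simp

lemma sum_prod_sign {ι : Type*} [Fintype ι] [DecidableEq ι] {k : ℕ} (f : Fin k → ι) :
    ∑ s : ι → Bool, ∏ i, (if s (f i) then (1 : ℂ) else -1)
      = if ∀ e, Even (Finset.univ.filter fun i => f i = e).card
        then (2 : ℂ) ^ Fintype.card ι else 0 := by
  have h1 : ∀ s : ι → Bool, ∏ i, (if s (f i) then (1 : ℂ) else -1)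
      = ∏ e, (if s e then (1 : ℂ) else -1) ^ (Finset.univ.filter fun i => f i = e).card := by
    intro s
    rw [← Finset.prod_fiberwise' Finset.univ f fun e => if s e then (1 : ℂ) else -1]
    simp only [Finset.prod_const]
  have h2 := Finset.prod_univ_sum (fun _ : ι => (Finset.univ : Finset Bool))
    fun e b => (if b then (1 : ℂ) else -1) ^ (Finset.univ.filter fun i => f i = e).card
  rw [Fintype.piFinset_univ] at h2
  rw [Finset.sum_congr rfl fun s _ => h1 s, ← h2]
  have h3 : ∀ e, ∑ b : Bool,
      (if b then (1 : ℂ) else -1) ^ (Finset.univ.filter fun i => f i = e).card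
      = if Even (Finset.univ.filter fun i => f i = e).card then 2 else 0 := by
    intro e
    rw [Fintype.sum_bool]
    by_cases h : Even (Finset.univ.filter fun i => f i = e).card
    · simp only [if_true, Bool.false_eq_true, if_false, one_pow, h.neg_one_pow, h]
      norm_num
    · simp only [if_true, Bool.false_eq_true, if_false, one_pow,
        (Nat.not_even_iff_odd.mp h).neg_one_pow, h]
      norm_num
  rw [Finset.prod_congr rfl fun e _ => h3 e]
  by_cases h : ∀ e, Even (Finset.univ.filter fun i => f i = e).card
  · rw [if_pos h, Finset.prod_congr rfl fun e _ => if_pos (h e), Finset.prod_const,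
      Finset.card_univ]
  · rw [if_neg h]
    push Not at h
    obtain ⟨e, he⟩ := h
    exact Finset.prod_eq_zero (Finset.mem_univ e) (if_neg he)

lemma list_prod_ofFn_smul {A : Type*} [Semiring A] [Algebra ℂ A] {k : ℕ} (c : Fin k → ℂ)
    (g : Fin k → A) :
    (List.ofFn fun i => c i • g i).prod = (∏ i, c i) • (List.ofFn g).prod := by
  induction k with
  | zero => simp
  | succ k ih =>
    rw [List.ofFn_succ, List.prod_cons, ih, Fin.prod_univ_succ, List.ofFn_succ, List.prod_cons,
      smul_mul_smul_comm]

lemma sum_ntr_pow_hsyk (m q : ℕ) (β : ℝ) (k : ℕ) :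
    (∑ s, ntr m (((β : ℂ) • Hsyk m q s) ^ k)) /
      (2 : ℂ) ^ (Fintype.card {I : Finset (Fin (2 * m)) // I.card = q})
    = ((β * sigma q (2 * m) : ℝ) : ℂ) ^ k *
      ∑ f : Fin k → {I : Finset (Fin (2 * m)) // I.card = q},
        if ∀ e, Even (Finset.univ.filter fun i => f i = e).card
        then ntr m (List.ofFn fun i => psiMSet m q (f i).val).prod else 0 := by
  have h1 : ∀ s, ntr m (((β : ℂ) • Hsyk m q s) ^ k)
      = ∑ f : Fin k → {I : Finset (Fin (2 * m)) // I.card = q},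
        ((β * sigma q (2 * m) : ℝ) : ℂ) ^ k * (∏ i, (if s (f i) then (1 : ℂ) else -1)) *
          ntr m (List.ofFn fun i => psiMSet m q (f i).val).prod := by
    intro s
    have h2 : (β : ℂ) • Hsyk m q s = ∑ I : {I : Finset (Fin (2 * m)) // I.card = q},
        (((β * sigma q (2 * m) : ℝ) : ℂ) * (if s I then (1 : ℂ) else -1)) •
          psiMSet m q I.val := by
      rw [Hsyk, Finset.smul_sum]
      refine Finset.sum_congr rfl fun I _ => ?_
      rw [smul_smul]
      congr 1
      by_cases h : s I = true <;> simp [h]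
    rw [h2, sum_pow_eq_sum_ofFn, map_sum]
    refine Finset.sum_congr rfl fun f _ => ?_
    rw [list_prod_ofFn_smul, map_smul, smul_eq_mul, Finset.prod_mul_distrib, Finset.prod_const,
      Finset.card_univ, Fintype.card_fin]
  rw [Finset.sum_congr rfl fun s _ => h1 s, Finset.sum_comm, Finset.mul_sum, Finset.sum_div]
  refine Finset.sum_congr rfl fun f _ => ?_
  rw [← Finset.sum_mul, ← Finset.mul_sum, sum_prod_sign]
  by_cases h : ∀ e, Even (Finset.univ.filter fun i => f i = e).card
  · rw [if_pos h, if_pos h]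
    field_simp
  · rw [if_neg h, if_neg h]
    simp

lemma gam_eq_ntr {m q : ℕ} (hq : Even q) (β : ℝ) {r : Finset (Fin (2 * m)) → ℕ}
    (hr : Adm q r) {k : ℕ} (hk : ∑ e, r e = k) :
    (gam q (xpar q (2 * m) β) r : ℂ) = (k.factorial : ℂ)⁻¹ *
      (((β * sigma q (2 * m) : ℝ) : ℂ) ^ k * ntr m (seqSum (psiMSet m q) r k)) := by
  obtain ⟨Φ, hΦ⟩ := exists_algHom_psiM m q
  have h1 : seqSum (psiMSet m q) r k
      = ((bMulti q r k : ℂ) * ((2 : ℂ) ^ (q * k / 2))⁻¹) • 1 := by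
    have h2 := congrArg Φ (seqSum_psiSet hr k)
    have h3 := map_seqSum Φ.toRingHom (psiSet q : Finset (Fin (2 * m)) → Cliff (2 * m)) r k
    simp only [AlgHom.toRingHom_eq_coe, RingHom.coe_coe, hΦ] at h3
    rw [map_smul, map_one, h3] at h2
    exact h2
  rw [h1, map_smul, ntr_one, gam, hk, xpar]
  have h4 : q * k / 2 = q / 2 * k := by
    obtain ⟨p, rfl⟩ := hq
    rw [show (p + p) * k = 2 * (p * k) by ring, show p + p = 2 * p by ring]
    simp
  rw [h4, pow_mul]
  push_cast
  simp only [smul_eq_mul, mul_one, mul_pow, inv_pow]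
  ring

lemma tsum_gam_fiber {m q : ℕ} (hq : Even q) (β : ℝ) (k : ℕ) :
    ((∑' r : Finset (Fin (2 * m)) → ℕ, if Adm q r ∧ ∑ e, r e = k
        then gam q (xpar q (2 * m) β) r else 0 : ℝ) : ℂ)
      = (k.factorial : ℂ)⁻¹ * (((β * sigma q (2 * m) : ℝ) : ℂ) ^ k *
        ∑ f : Fin k → Finset (Fin (2 * m)),
          if Adm q (fun e => (Finset.univ.filter fun i => f i = e).card)
          then ntr m (List.ofFn fun i => psiMSet m q (f i)).prod else 0) := by
  rw [Complex.ofReal_tsum, ← mul_assoc, Finset.mul_sum]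
  have h1 : ∀ r : Finset (Fin (2 * m)) → ℕ,
      ((if Adm q r ∧ ∑ e, r e = k then gam q (xpar q (2 * m) β) r else 0 : ℝ) : ℂ)
      = ∑ f : Fin k → Finset (Fin (2 * m)),
        if r = (fun e => (Finset.univ.filter fun i => f i = e).card) then
          (k.factorial : ℂ)⁻¹ * ((β * sigma q (2 * m) : ℝ) : ℂ) ^ k *
          (if Adm q (fun e => (Finset.univ.filter fun i => f i = e).card)
          then ntr m (List.ofFn fun i => psiMSet m q (f i)).prod else 0) else 0 := by
    intro r
    by_cases h : Adm q r ∧ ∑ e, r e = k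
    · rw [if_pos h, gam_eq_ntr hq β h.1 h.2, seqSum, map_sum, ← mul_assoc, Finset.mul_sum]
      refine Finset.sum_congr rfl fun f _ => ?_
      by_cases hf : r = fun e => (Finset.univ.filter fun i => f i = e).card
      · rw [if_pos hf, if_pos (hf ▸ h.1 : Adm q _), if_pos]
        intro e
        convert (congrFun hf e).symm
      · rw [if_neg hf, if_neg, map_zero, mul_zero]
        intro h'
        refine hf (funext fun e => ?_)
        convert (h' e).symm
    · rw [if_neg h, Complex.ofReal_zero]
      refine (Finset.sum_eq_zero fun f _ => ?_).symm
      by_cases hf : r = fun e => (Finset.univ.filter fun i => f i = e).card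
      · rw [if_pos hf, if_neg, mul_zero]
        intro hA
        refine h ⟨hf ▸ hA, ?_⟩
        rw [hf, ← Finset.card_eq_sum_card_fiberwise fun _ _ => Finset.mem_univ _]
        simp
      · rw [if_neg hf]
  rw [tsum_congr h1, Summable.tsum_finsetSum]
  · exact Finset.sum_congr rfl fun f _ => tsum_ite_eq _ _
  · intro f _
    exact (hasSum_ite_eq _ _).summable

lemma sum_adm_eq_sum_subtype {m q k : ℕ} (G : (Fin k → Finset (Fin (2 * m))) → ℂ) :
    (∑ f : Fin k → Finset (Fin (2 * m)),
      if Adm q (fun e => (Finset.univ.filter fun i => f i = e).card) then G f else 0)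
    = ∑ f : Fin k → {I : Finset (Fin (2 * m)) // I.card = q},
        if ∀ e, Even (Finset.univ.filter fun i => f i = e).card
        then G (fun i => (f i).val) else 0 := by
  symm
  refine Fintype.sum_of_injective
    (fun (f : Fin k → {I : Finset (Fin (2 * m)) // I.card = q}) i => (f i).val)
    (fun f g h => funext fun i => Subtype.ext (congrFun h i)) _ _ ?_ ?_
  · intro f hf
    rw [if_neg]
    intro hA
    refine hf ⟨fun i => ⟨f i, hA.1 (f i) ?_⟩, rfl⟩
    exact Finset.card_ne_zero.mpr ⟨i, by simp⟩
  · intro f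
    have h1 : (∀ e, Even (Finset.univ.filter fun i => f i = e).card) ↔
        Adm q (fun e => (Finset.univ.filter fun i => (f i).val = e).card) := by
      constructor
      · intro h
        have h2 : ∀ e, (Finset.univ.filter fun i => (f i).val = e).card ≠ 0 → e.card = q := by
          intro e he
          obtain ⟨i, hi⟩ := Finset.card_ne_zero.mp he
          rw [← (Finset.mem_filter.mp hi).2]
          exact (f i).2
        refine ⟨h2, fun e => ?_⟩
        by_cases he : (Finset.univ.filter fun i => (f i).val = e).card = 0
        · simp only [he, Even.zero]
        · have := h ⟨e, h2 e he⟩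
          simpa only [Subtype.ext_iff] using this
      · intro h e
        have := h.2 e.val
        simpa only [Subtype.ext_iff] using this
    by_cases h : ∀ e, Even (Finset.univ.filter fun i => f i = e).card
    · rw [if_pos h, if_pos (h1.mp h)]
    · rw [if_neg h, if_neg fun h' => h (h1.mpr h')]

theorem EZ_eq_totalW {m q : ℕ} (hq : Even q) (β : ℝ) :
    EZ m q β = (totalW q (xpar q (2 * m) β) (Finset.univ : Finset (Fin (2 * m))) : ℂ) := by
  have h1 : HasSum (fun k : ℕ => (k.factorial : ℂ)⁻¹ * ((∑ s, ntr m (((β : ℂ) • Hsyk m q s) ^ k)) /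
      (2 : ℂ) ^ (Fintype.card {I : Finset (Fin (2 * m)) // I.card = q}))) (EZ m q β) := by
    have h2 := (hasSum_sum (s := Finset.univ) fun s _ =>
      hasSum_ntr_expM ((β : ℂ) • Hsyk m q s)).div_const
        ((2 : ℂ) ^ (Fintype.card {I : Finset (Fin (2 * m)) // I.card = q}))
    refine h2.congr_fun fun k => ?_
    rw [← Finset.mul_sum, mul_div_assoc]
  have h3 := (summable_ite_gam q (xpar q (2 * m) β) (fun r : Finset (Fin (2 * m)) → ℕ =>
    Adm q r ∧ SuppIn Finset.univ r)).hasSum.tsum_fiberwise fun r => ∑ e, r e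
  have h4 : HasSum (fun k : ℕ => ∑' r : Finset (Fin (2 * m)) → ℕ, if Adm q r ∧ ∑ e, r e = k
        then gam q (xpar q (2 * m) β) r else 0)
      (totalW q (xpar q (2 * m) β) (Finset.univ : Finset (Fin (2 * m)))) := by
    refine h3.congr_fun fun k => ?_
    symm
    rw [tsum_subtype _ (fun r : Finset (Fin (2 * m)) → ℕ =>
      if Adm q r ∧ SuppIn Finset.univ r then gam q (xpar q (2 * m) β) r else 0)]
    refine tsum_congr fun r => ?_
    have hS : SuppIn Finset.univ r := fun e _ => Finset.subset_univ e
    by_cases hA : Adm q r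
    · by_cases hk : ∑ e, r e = k
      · rw [Set.indicator_of_mem (by simpa using hk), if_pos ⟨hA, hS⟩, if_pos ⟨hA, hk⟩]
      · rw [Set.indicator_of_notMem (by simpa using hk), if_neg fun h => hk h.2]
    · rw [if_neg fun h => hA h.1]
      exact (Set.indicator_apply_eq_zero.mpr fun _ => if_neg fun h' => hA h'.1)
  refine h1.unique ?_
  refine (Complex.hasSum_ofReal.mpr h4).congr_fun fun k => ?_
  rw [tsum_gam_fiber hq, sum_ntr_pow_hsyk, sum_adm_eq_sum_subtype]

end PartitionFunction

section Bound

variable {v : ℕ}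

lemma sum_seqSum_div_factorial_le {q k : ℕ} (F : Finset (Finset (Fin v) → ℕ))
    (hF : ∀ r ∈ F, Adm q r ∧ ∑ e, r e = 2 * k) :
    ∑ r ∈ F, seqSum (fun _ => (1 : ℝ)) r (2 * k) / (2 * k).factorial
      ≤ ((v : ℝ) ^ q) ^ k / k.factorial := by
  set g : Finset (Fin v) → ℝ := fun e => if e.card = q then 1 else 0 with hg
  have hg0 : ∀ e, 0 ≤ g e := fun e => by
    by_cases h : e.card = q <;> simp [hg, h]
  have hgs : ∑ e, g e ≤ (v : ℝ) ^ q := by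
    have : ∑ e, g e = (v.choose q : ℝ) := by
      rw [hg, Finset.sum_boole, ← Finset.powerset_univ, ← Finset.powersetCard_eq_filter]
      simp
    rw [this]
    exact_mod_cast Nat.choose_le_pow v q
  have hterm : ∀ r ∈ F, seqSum (fun _ => (1 : ℝ)) r (2 * k) / (2 * k).factorial
      ≤ seqSum g (fun e => r e / 2) k / k.factorial := by
    intro r hr
    obtain ⟨hA, hs⟩ := hF r hr
    have h2 : ∀ e, 2 * (r e / 2) = r e := fun e => Nat.mul_div_cancel' (hA.2 e).two_dvd
    have h1 := prod_factorial_mul_seqSum (fun _ : Finset (Fin v) => (1 : ℝ)) (2 * k) r hs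
    have h3 := prod_factorial_mul_seqSum g k (fun e => r e / 2) (by
      have : 2 * ∑ e, r e / 2 = 2 * k := by
        rw [Finset.mul_sum, ← hs]
        exact Finset.sum_congr rfl fun e _ => h2 e
      omega)
    have h4 : ∏ e, g e ^ (r e / 2) = 1 := by
      refine Finset.prod_eq_one fun e _ => ?_
      by_cases h : r e = 0
      · simp [h]
      · simp [hg, hA.1 e h]
    simp only [one_pow, Finset.prod_const_one, mul_one] at h1
    rw [h4, mul_one] at h3
    have p1 : 0 < ((∏ e, (r e).factorial : ℕ) : ℝ) := by
      exact_mod_cast Finset.prod_pos fun e _ => Nat.factorial_pos _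
    have p2 : 0 < ((∏ e, (r e / 2).factorial : ℕ) : ℝ) := by
      exact_mod_cast Finset.prod_pos fun e _ => Nat.factorial_pos _
    have p3 : ((∏ e, (r e / 2).factorial : ℕ) : ℝ) ≤ ((∏ e, (r e).factorial : ℕ) : ℝ) := by
      exact_mod_cast Finset.prod_le_prod' fun e _ => Nat.factorial_le (Nat.div_le_self _ _)
    have e1 : seqSum (fun _ : Finset (Fin v) => (1 : ℝ)) r (2 * k) / (2 * k).factorial
        = 1 / ((∏ e, (r e).factorial : ℕ) : ℝ) := by
      rw [div_eq_div_iff (by positivity) p1.ne', mul_comm, h1, one_mul]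
    have e2 : seqSum g (fun e => r e / 2) k / k.factorial
        = 1 / ((∏ e, (r e / 2).factorial : ℕ) : ℝ) := by
      rw [div_eq_div_iff (by positivity) p2.ne', mul_comm, h3, one_mul]
    rw [e1, e2]
    exact one_div_le_one_div_of_le p2 p3
  calc ∑ r ∈ F, seqSum (fun _ => (1 : ℝ)) r (2 * k) / (2 * k).factorial
      ≤ ∑ r ∈ F, seqSum g (fun e => r e / 2) k / k.factorial := Finset.sum_le_sum hterm
    _ = (∑ s ∈ F.image fun r e => r e / 2, seqSum g s k) / k.factorial := by
        rw [Finset.sum_image, Finset.sum_div]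
        intro r hr s hs h
        funext e
        have h1 := Nat.mul_div_cancel' ((hF r hr).1.2 e).two_dvd
        have h2 := Nat.mul_div_cancel' ((hF s hs).1.2 e).two_dvd
        have h3 := congrFun h e
        simp only at h3
        omega
    _ ≤ ((v : ℝ) ^ q) ^ k / k.factorial := by
        gcongr
        refine (sum_seqSum_le g hg0 _ k).trans ?_
        exact pow_le_pow_left₀ (Finset.sum_nonneg fun e _ => hg0 e) hgs k

lemma xpar_sq_mul_le {q n : ℕ} (hn : 0 < n) (β : ℝ) :
    xpar q n β ^ 2 * (n : ℝ) ^ (q - 1) ≤ β ^ 2 * (q - 1).factorial := by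
  have h1 : sigma q n ^ 2 = (q - 1).factorial / (n : ℝ) ^ (q - 1) :=
    Real.sq_sqrt (by positivity)
  have h2 : (((2 : ℝ) ^ (q / 2))⁻¹) ^ 2 ≤ 1 :=
    pow_le_one₀ (by positivity) (inv_le_one_of_one_le₀ (one_le_pow₀ one_le_two))
  have hn' : (0 : ℝ) < (n : ℝ) ^ (q - 1) := by positivity
  rw [xpar, mul_pow, mul_pow, h1]
  have : β ^ 2 * (((2 : ℝ) ^ (q / 2))⁻¹) ^ 2 * ((q - 1).factorial / (n : ℝ) ^ (q - 1)) *
      (n : ℝ) ^ (q - 1) = (β ^ 2 * (q - 1).factorial) * (((2 : ℝ) ^ (q / 2))⁻¹) ^ 2 := by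
    field_simp
  rw [this]
  exact mul_le_of_le_one_right (by positivity) h2

lemma abs_muVD_zero_le {q n : ℕ} (hq2 : 2 ≤ q) (hn : 0 < n) {β : ℝ}
    (hβ : β ^ 2 * (q - 1).factorial ≤ (Real.exp (-2) / 4) ^ (q - 1)) (hv : 1 ≤ v) :
    |muVD q n β v 0| ≤ Real.exp 2 * (1 / 4) ^ (v - 1) := by
  by_cases hex : ∃ r, IsMultiHG q v 0 r
  swap
  · push Not at hex
    rw [muVD_eq_tsum hq2]
    simp only [hex, if_false, tsum_zero, mul_zero, abs_zero]
    positivity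
  obtain ⟨r₀, hr₀⟩ := hex
  obtain ⟨k, hk⟩ : ∃ k, v - 1 = (q - 1) * k := by
    obtain ⟨⟨hA, -⟩, h⟩ := isMultiHG_iff.mp hr₀
    obtain ⟨k, hk⟩ : Even (∑ e, r₀ e) := Finset.even_sum _ fun e _ => hA.2 e
    refine ⟨k, ?_⟩
    rw [hk, mul_add] at h
    omega
  have hsum : ∀ r, IsMultiHG q v 0 r → Adm q r ∧ ∑ e, r e = 2 * k := by
    intro r hr
    obtain ⟨⟨hA, -⟩, h⟩ := isMultiHG_iff.mp hr
    refine ⟨hA, ?_⟩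
    rw [add_zero, hk, mul_left_comm] at h
    exact Nat.eq_of_mul_eq_mul_left (by omega) h
  set x := xpar q n β with hx
  have hS := summable_ite_gam q x (fun r : Finset (Fin v) → ℕ => IsMultiHG q v 0 r)
  have hinner : |∑' r : Finset (Fin v) → ℕ, if IsMultiHG q v 0 r then gam q x r else 0|
      ≤ |x| ^ (2 * k) * (((v : ℝ) ^ q) ^ k / k.factorial) := by
    rw [← Real.norm_eq_abs]
    refine (norm_tsum_le_tsum_norm hS.norm).trans (hS.norm.tsum_le_of_sum_le fun F => ?_)
    have h1 : ∀ r : Finset (Fin v) → ℕ, ‖if IsMultiHG q v 0 r then gam q x r else 0‖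
        ≤ if IsMultiHG q v 0 r then
          |x| ^ (2 * k) * (seqSum (fun _ => (1 : ℝ)) r (2 * k) / (2 * k).factorial) else 0 := by
      intro r
      by_cases h : IsMultiHG q v 0 r
      · rw [if_pos h, if_pos h, Real.norm_eq_abs]
        have h2 := abs_gam_le q x r
        rw [(hsum r h).2] at h2
        refine h2.trans (le_of_eq (by ring))
      · rw [if_neg h, if_neg h, norm_zero]
    refine (Finset.sum_le_sum fun r _ => h1 r).trans ?_
    rw [← Finset.sum_filter, ← Finset.mul_sum]
    gcongr
    exact sum_seqSum_div_factorial_le _ fun r hr => hsum r (Finset.mem_filter.mp hr).2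
  rw [muVD_eq_tsum hq2, abs_mul, abs_of_nonneg (by positivity : (0 : ℝ) ≤ (n : ℝ) ^ (v - 1) /
    v.factorial)]
  have hvv : ((v : ℝ) ^ q) ^ k ≤ (v : ℝ) ^ k * (v : ℝ) ^ v := by
    rw [← pow_mul, ← pow_add]
    refine pow_le_pow_right₀ (by exact_mod_cast hv) ?_
    have : q * k = (q - 1) * k + k := by
      rw [← Nat.succ_mul]
      congr 1
      omega
    omega
  have hx2 : (n : ℝ) ^ (v - 1) * |x| ^ (2 * k) ≤ (Real.exp (-2) / 4) ^ (v - 1) := by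
    rw [hk, pow_mul, pow_mul, pow_mul, sq_abs, ← mul_pow, mul_comm]
    exact pow_le_pow_left₀ (by positivity) ((xpar_sq_mul_le hn β).trans hβ) k
  have e1 := Real.pow_div_factorial_le_exp (v : ℝ) (Nat.cast_nonneg v) k
  have e2 := Real.pow_div_factorial_le_exp (v : ℝ) (Nat.cast_nonneg v) v
  calc (n : ℝ) ^ (v - 1) / v.factorial *
        |∑' r : Finset (Fin v) → ℕ, if IsMultiHG q v 0 r then gam q x r else 0|
      ≤ (n : ℝ) ^ (v - 1) / v.factorial *
        (|x| ^ (2 * k) * ((v : ℝ) ^ k * (v : ℝ) ^ v / k.factorial)) := by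
        gcongr
        exact hinner.trans (by gcongr)
    _ = ((n : ℝ) ^ (v - 1) * |x| ^ (2 * k)) *
        (((v : ℝ) ^ k / k.factorial) * ((v : ℝ) ^ v / v.factorial)) := by
        field_simp
    _ ≤ (Real.exp (-2) / 4) ^ (v - 1) * (Real.exp v * Real.exp v) := by
        gcongr
    _ = Real.exp 2 * (1 / 4) ^ (v - 1) := by
        obtain ⟨u, rfl⟩ : ∃ u, v = u + 1 := ⟨v - 1, by omega⟩
        rw [div_pow, ← Real.exp_nat_mul, ← Real.exp_add]
        have : Real.exp 2 = Real.exp (((u + 1 - 1 : ℕ) : ℝ) * (-2)) *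
            Real.exp (((u + 1 : ℕ) : ℝ) + ((u + 1 : ℕ) : ℝ)) := by
          rw [← Real.exp_add]
          congr 1
          push_cast [Nat.add_sub_cancel]
          ring
        rw [this, one_div, inv_pow]
        ring

end Bound

section Analytic

open Topology

lemma iteratedDeriv_eq_of_hasSum {c : ℕ → ℂ} {E : ℂ → ℂ}
    (h : ∀ᶠ z in 𝓝 (0 : ℂ), HasSum (fun k => c k * z ^ k) (E z)) :
    AnalyticAt ℂ E 0 ∧ ∀ k, iteratedDeriv k E 0 = k.factorial * c k := by
  have hp : HasFPowerSeriesAt E (FormalMultilinearSeries.ofScalars ℂ c) 0 := by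
    rw [hasFPowerSeriesAt_iff]
    filter_upwards [h] with z hz
    simpa [FormalMultilinearSeries.coeff_ofScalars, mul_comm] using hz
  have ha : AnalyticAt ℂ E 0 := hp.analyticAt
  refine ⟨ha, fun k => ?_⟩
  have h1 := congr_arg (FormalMultilinearSeries.coeff · k)
    (ha.hasFPowerSeriesAt.eq_formalMultilinearSeries hp)
  simp only [FormalMultilinearSeries.coeff_ofScalars] at h1
  rw [div_eq_iff (by exact_mod_cast k.factorial_ne_zero)] at h1
  rw [h1, mul_comm]

lemma iteratedDeriv_succ_cexp {E : ℂ → ℂ} {z : ℂ} (hE : AnalyticAt ℂ E z) (k : ℕ) :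
    iteratedDeriv (k + 1) (fun z => Complex.exp (E z)) z =
      ∑ i ∈ Finset.range (k + 1), (k.choose i : ℂ) * iteratedDeriv (i + 1) E z *
        iteratedDeriv (k - i) (fun z => Complex.exp (E z)) z := by
  have hd : deriv (fun z => Complex.exp (E z)) =ᶠ[𝓝 z]
      (deriv E * fun z => Complex.exp (E z)) := by
    filter_upwards [hE.eventually_analyticAt] with w hw
    rw [hw.differentiableAt.hasDerivAt.cexp.deriv, Pi.mul_apply, mul_comm]
  rw [iteratedDeriv_succ', hd.iteratedDeriv_eq k,
    iteratedDeriv_mul hE.deriv.contDiffAt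
      (show ContDiffAt ℂ _ (fun z => Complex.exp (E z)) z from hE.cexp.contDiffAt)]
  simp only [iteratedDeriv_succ']

lemma iteratedDeriv_cexp_eq_totalRec {c : ℕ → ℂ} {E : ℂ → ℂ} {w : ℕ → ℝ} {a : ℂ} {n : ℕ}
    (h : ∀ᶠ z in 𝓝 (0 : ℂ), HasSum (fun k => c k * z ^ k) (E z)) (hc0 : c 0 = 0)
    (hc : ∀ k, 1 ≤ k → k ≤ n → k.factorial * c k = a ^ k * w k) (k : ℕ) (hk : k ≤ n) :
    iteratedDeriv k (fun z => Complex.exp (E z)) 0 = a ^ k * totalRec w k := by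
  obtain ⟨ha, hi⟩ := iteratedDeriv_eq_of_hasSum h
  induction k using Nat.strong_induction_on with
  | _ k ih =>
    cases k with
    | zero =>
      have := hi 0
      rw [hc0, mul_zero, iteratedDeriv_zero] at this
      simp [this, totalRec]
    | succ k =>
      rw [iteratedDeriv_succ_cexp ha, totalRec_succ, Complex.ofReal_sum, Finset.mul_sum]
      refine Finset.sum_congr rfl fun i hik => ?_
      rw [Finset.mem_range] at hik
      rw [hi, hc (i + 1) (by omega) (by omega), ih (k - i) (by omega) (by omega),
        show k + 1 = (i + 1) + (k - i) by omega, pow_add]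
      push_cast
      ring

variable {q n : ℕ} {β : ℝ}

lemma norm_muVD_mul_pow_le (hq2 : 2 ≤ q) (hn : 0 < n)
    (hβ : β ^ 2 * (q - 1).factorial ≤ (Real.exp (-2) / 4) ^ (q - 1)) {z : ℂ} (hz : ‖z‖ ≤ 3)
    (v : ℕ) : ‖(muVD q n β (v + 1) 0 : ℂ) * z ^ (v + 1)‖ ≤ Real.exp 2 * 3 * (3 / 4) ^ v := by
  rw [norm_mul, norm_pow, Complex.norm_real, Real.norm_eq_abs]
  calc _ ≤ Real.exp 2 * (1 / 4) ^ (v + 1 - 1) * 3 ^ (v + 1) := by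
        gcongr
        exact abs_muVD_zero_le hq2 hn hβ (by omega)
    _ = _ := by
        rw [Nat.add_sub_cancel, pow_succ, div_pow, div_pow]
        ring

lemma summable_const_mul_geometric (a : ℝ) : Summable fun v : ℕ => a * (3 / 4 : ℝ) ^ v :=
  (summable_geometric_of_lt_one (by norm_num) (by norm_num)).mul_left a

lemma summable_norm_muVD_mul_pow (hq2 : 2 ≤ q) (hn : 0 < n)
    (hβ : β ^ 2 * (q - 1).factorial ≤ (Real.exp (-2) / 4) ^ (q - 1)) {z : ℂ} (hz : ‖z‖ ≤ 3) :
    Summable fun v : ℕ => ‖(muVD q n β (v + 1) 0 : ℂ) * z ^ (v + 1)‖ :=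
  Summable.of_nonneg_of_le (fun _ => norm_nonneg _) (norm_muVD_mul_pow_le hq2 hn hβ hz)
    (summable_const_mul_geometric _)

lemma analyticAt_M0 (hq2 : 2 ≤ q) (hn : 0 < n)
    (hβ : β ^ 2 * (q - 1).factorial ≤ (Real.exp (-2) / 4) ^ (q - 1)) {z : ℂ} (hz : ‖z‖ < 3) :
    AnalyticAt ℂ (M0 q n β) z := by
  have hd : DifferentiableOn ℂ
      (fun z : ℂ => ∑' v : ℕ, (muVD q n β (v + 1) 0 : ℂ) * z ^ (v + 1)) (Metric.ball 0 3) :=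
    Complex.differentiableOn_tsum_of_summable_norm (summable_const_mul_geometric _)
      (fun v => by fun_prop) Metric.isOpen_ball
      (fun v w hw => norm_muVD_mul_pow_le hq2 hn hβ (mem_ball_zero_iff.mp hw).le v)
  have ha := hd.analyticAt (Metric.isOpen_ball.mem_nhds (mem_ball_zero_iff.mpr hz))
  exact (analyticAt_const.mul ha).cexp

lemma analyticAt_DeltaM (z : ℂ) : AnalyticAt ℂ (DeltaM q n β) z := by
  have h : Differentiable ℂ (DeltaM q n β) := by
    unfold DeltaM
    simp only [tsum_mul_right]
    fun_prop
  exact h.analyticAt z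

/-- The Taylor coefficients of `log M`. -/
def logCoef (q n : ℕ) (β : ℝ) (k : ℕ) : ℂ :=
  (n : ℂ) * ((if k = 0 then 0 else (muVD q n β k 0 : ℂ)) +
    if k ∈ Finset.Icc 1 n then ∑' Δ : ℕ, (muVD q n β k (Δ + 1) : ℂ) else 0)

lemma factorial_mul_logCoef (hq2 : 2 ≤ q) {k : ℕ} (hk : 1 ≤ k) (hkn : k ≤ n) :
    k.factorial * logCoef q n β k =
      (n : ℂ) ^ k * connW q (xpar q n β) (Finset.univ : Finset (Fin k)) := by
  have h := hasSum_muVD hq2 n β k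
  have h1 := h.summable.tsum_eq_zero_add
  rw [h.tsum_eq] at h1
  rw [logCoef, if_neg (by omega), if_pos (Finset.mem_Icc.mpr ⟨hk, hkn⟩), ← Complex.ofReal_tsum,
    ← Complex.ofReal_add, ← h1]
  obtain ⟨k, rfl⟩ : ∃ j, k = j + 1 := ⟨k - 1, by omega⟩
  have hf : ((k + 1).factorial : ℂ) ≠ 0 := by exact_mod_cast (k + 1).factorial_ne_zero
  rw [Nat.add_sub_cancel]
  push_cast
  field_simp
  ring

lemma exists_Mfun_eq_cexp (hq2 : 2 ≤ q) (hn : 0 < n)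
    (hβ : β ^ 2 * (q - 1).factorial ≤ (Real.exp (-2) / 4) ^ (q - 1)) :
    ∃ E : ℂ → ℂ, Mfun q n β = (fun z => Complex.exp (E z)) ∧
      ∀ᶠ z in 𝓝 (0 : ℂ), HasSum (fun k => logCoef q n β k * z ^ k) (E z) := by
  refine ⟨fun z => (n : ℂ) * (∑' v : ℕ, (muVD q n β (v + 1) 0 : ℂ) * z ^ (v + 1)) + (n : ℂ) *
    ∑ v ∈ Finset.Icc 1 n, ∑' Δ : ℕ, (muVD q n β v (Δ + 1) : ℂ) * z ^ v, ?_, ?_⟩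
  · ext z
    rw [Complex.exp_add]
    rfl
  · filter_upwards [Metric.ball_mem_nhds (0 : ℂ) (by norm_num : (0 : ℝ) < 3)] with z hz
    have h1 := (summable_norm_muVD_mul_pow hq2 hn hβ (mem_ball_zero_iff.mp hz).le).of_norm.hasSum
    have h2 : HasSum (fun k => (if k = 0 then 0 else (muVD q n β k 0 : ℂ)) * z ^ k)
        (∑' v : ℕ, (muVD q n β (v + 1) 0 : ℂ) * z ^ (v + 1)) := by
      rw [← hasSum_nat_add_iff' 1]
      simpa using h1
    have h3 : HasSum (fun k => (if k ∈ Finset.Icc 1 n then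
          ∑' Δ : ℕ, (muVD q n β k (Δ + 1) : ℂ) else 0) * z ^ k)
        (∑ v ∈ Finset.Icc 1 n, ∑' Δ : ℕ, (muVD q n β v (Δ + 1) : ℂ) * z ^ v) := by
      have h4 := hasSum_sum_of_ne_finset_zero (s := Finset.Icc 1 n)
        (L := SummationFilter.unconditional ℕ)
        (f := fun k => (if k ∈ Finset.Icc 1 n then
          ∑' Δ : ℕ, (muVD q n β k (Δ + 1) : ℂ) else 0) * z ^ k)
        fun k hk => by rw [if_neg hk, zero_mul]
      convert h4 using 1
      refine Finset.sum_congr rfl fun k hk => ?_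
      rw [if_pos hk, tsum_mul_right]
    rw [← mul_add]
    refine ((h2.add h3).mul_left (n : ℂ)).congr_fun fun k => ?_
    rw [logCoef]
    ring

lemma factorial_div_pow_mul_Mcoef (hq2 : 2 ≤ q) (hn : 0 < n)
    (hβ : β ^ 2 * (q - 1).factorial ≤ (Real.exp (-2) / 4) ^ (q - 1)) :
    ((n.factorial : ℂ) / (n : ℂ) ^ n) * Mcoef q n β =
      totalRec (fun u => connW q (xpar q n β) (Finset.univ : Finset (Fin u))) n := by
  obtain ⟨E, hM, hE⟩ := exists_Mfun_eq_cexp hq2 hn hβ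
  have h := iteratedDeriv_cexp_eq_totalRec (n := n) hE (by simp [logCoef])
    (fun k => factorial_mul_logCoef hq2) n le_rfl
  have hf : (n.factorial : ℂ) ≠ 0 := by exact_mod_cast n.factorial_ne_zero
  have hn' : (n : ℂ) ≠ 0 := by exact_mod_cast hn.ne'
  rw [Mcoef, hM, h]
  field_simp

end Analytic

/-- For small enough `β*`, `|β| ≤ β*`, and even `n = 2m ≥ q`: the series
defining `M₀` and `ΔM` converge and the two functions are analytic on `{|z| ≤ 2}`, and
`E[Z_{n,q}(β)] = (n!/nⁿ) Mₙ`, where `Mₙ` is the coefficient of `zⁿ` in `M = M₀ ΔM`. -/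
theorem EZ_eq_Mcoef (q : ℕ) (hq : Even q) (hq2 : 2 ≤ q) :
    ∃ βs : ℝ, 0 < βs ∧ ∀ β : ℝ, |β| ≤ βs → ∀ m : ℕ, q ≤ 2 * m →
      (∀ z : ℂ, ‖z‖ ≤ 2 →
        Summable (fun v : ℕ => ‖(muVD q (2 * m) β (v + 1) 0 : ℂ) * z ^ (v + 1)‖)) ∧
      (∀ v ∈ Finset.Icc 1 (2 * m),
        Summable (fun Δ : ℕ => |muVD q (2 * m) β v (Δ + 1)|)) ∧
      (∀ z : ℂ, ‖z‖ ≤ 2 →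
        AnalyticAt ℂ (M0 q (2 * m) β) z ∧ AnalyticAt ℂ (DeltaM q (2 * m) β) z) ∧
      EZ m q β
        = (((2 * m).factorial : ℂ) / ((2 * m : ℕ) : ℂ) ^ (2 * m)) * Mcoef q (2 * m) β := by
  refine ⟨Real.sqrt ((Real.exp (-2) / 4) ^ (q - 1) / (q - 1).factorial),
    Real.sqrt_pos.mpr (by positivity), fun β hβs m hm => ?_⟩
  have hβ : β ^ 2 * (q - 1).factorial ≤ (Real.exp (-2) / 4) ^ (q - 1) := by
    rw [← le_div_iff₀ (by positivity), ← sq_abs]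
    exact (Real.le_sqrt (abs_nonneg β) (by positivity)).mp hβs
  have hn : 0 < 2 * m := by omega
  refine ⟨fun z hz => summable_norm_muVD_mul_pow hq2 hn hβ (by linarith), fun v _ => ?_,
    fun z hz => ⟨analyticAt_M0 hq2 hn hβ (by linarith), analyticAt_DeltaM z⟩, ?_⟩
  · exact ((summable_nat_add_iff 1).mpr (hasSum_muVD hq2 (2 * m) β v).summable).abs
  · rw [EZ_eq_totalW hq, factorial_div_pow_mul_Mcoef hq2 hn hβ,
      totalW_eq_totalRec hq hq2 _ (2 * m) Finset.univ (by simp)]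

end SYK
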